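/- arXiv:1211.6974 — 2 statements merged into one kernel-verified Lean document; each statement's English description precedes it below -/
import Mathlib

section
/- For n ≥ 1, 0 ≤ k ≤ n−1 and φ ∈ ℝ, let M_{n,k}(φ) be the n×n real tridiagonal matrix with diagonal entries 4 − 2cos(2πk/n + jφ) for j = 1,…,n, entries −1 on the sub- and super-diagonal, and 0 elsewhere. There exist constants K > 0 and c_0 > 0 such that for every c ∈ (0, c_0], limsup_{n→∞} | Π_{k=0}^{n−1} det M_{n,k}(c/n²) / det M_{n,k}(0) − 1 | ≤ K c². (In other words, the ratio of determinants of the connection Laplacian with total curvature c to that of the trivial connection on the wired n×n cylinder is 1 + O(c²) uniformly in n.) -/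
/-!
STATEMENT 13.  There are constants `K, c₀ > 0` such that for every total curvature
`c ∈ (0, c₀]`,
`limsup_{n→∞} | Π_{k=0}^{n−1} det M_{n,k}(c/n²) / det M_{n,k}(0) − 1 | ≤ K c²`,
where `M_{n,k}(φ)` is the `n×n` tridiagonal matrix with diagonal entries
`4 − 2cos(2πk/n + jφ)` (`j = 1,…,n`) and `−1` off the diagonal.
-/

noncomputable section

/-- The `n×n` tridiagonal matrix with diagonal entries `4 − 2cos(2πk/n + jφ)` for
`j = 1,…,n` and `−1` on the sub- and super-diagonal. -/
def Mblock (n k : ℕ) (φ : ℝ) : Matrix (Fin n) (Fin n) ℝ :=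
  Matrix.of fun (i j : Fin n) =>
    (if i = j then 4 - 2 * Real.cos (2 * Real.pi * k / n + ((i : ℕ) + 1) * φ) else 0)
      - (if (i : ℕ) = (j : ℕ) + 1 ∨ (j : ℕ) = (i : ℕ) + 1 then 1 else 0)

set_option linter.all false
set_option linter.unusedSimpArgs false


lemma aux_log (x : ℝ) (hx : |x| ≤ 1/2) : 0 < 1 + x ∧ |Real.log (1+x) - x + x^2/2| ≤ 2 * |x|^3 := by
  have h1 : |(-x)| < 1 := by rw [abs_neg]; linarith
  have h := Real.abs_log_sub_add_sum_range_le h1 2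
  simp [Finset.sum_range_succ] at h
  have hx' := abs_le.mp hx
  refine ⟨by linarith, ?_⟩
  have e : Real.log (1+x) - x + x^2/2 = -x + x^2/(1+1) + Real.log (1+x) := by ring
  rw [e]
  refine h.trans ?_
  rw [div_le_iff₀ (by linarith)]
  have : 0 ≤ |x|^3 := by positivity
  nlinarith

lemma aux_prod {ι : Type*} [Fintype ι] (x : ι → ℝ) (s : ℝ) (hs : ∑ i, x i ^ 2 = s) (hs4 : s ≤ 1/4) :
    0 < ∏ i, (1 + x i) ∧ |Real.log (∏ i, (1 + x i)) - ∑ i, x i + s/2| ≤ 2 * (s * Real.sqrt s) := by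
  have hs0 : 0 ≤ s := by rw [← hs]; positivity
  have hxs : ∀ i, |x i| ≤ Real.sqrt s := by
    intro i
    apply Real.abs_le_sqrt
    rw [← hs]
    exact Finset.single_le_sum (f := fun i => x i ^ 2) (fun i _ => by positivity) (Finset.mem_univ i)
  have hsq : Real.sqrt s ≤ 1/2 := by
    rw [Real.sqrt_le_left (by norm_num)]; linarith
  have hx : ∀ i, |x i| ≤ 1/2 := fun i => (hxs i).trans hsq
  refine ⟨Finset.prod_pos fun i _ => (aux_log _ (hx i)).1, ?_⟩
  rw [Real.log_prod (fun i _ => (aux_log _ (hx i)).1.ne')]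
  have : ∑ i, Real.log (1 + x i) - ∑ i, x i + s/2 = ∑ i, (Real.log (1+x i) - x i + x i^2/2) := by
    rw [Finset.sum_add_distrib, Finset.sum_sub_distrib, ← Finset.sum_div, hs]
  rw [this]
  refine (Finset.abs_sum_le_sum_abs _ _).trans ?_
  calc ∑ i, |Real.log (1+x i) - x i + x i^2/2| ≤ ∑ i, 2 * (x i ^2 * Real.sqrt s) := by
        apply Finset.sum_le_sum
        intro i _
        refine (aux_log _ (hx i)).2.trans ?_
        have : |x i|^3 = x i ^ 2 * |x i| := by rw [pow_succ, sq_abs]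
        rw [this]
        have := hxs i
        gcongr
    _ = _ := by rw [← Finset.mul_sum, ← Finset.sum_mul, hs]

open Matrix in
lemma aux_herm {n : ℕ} (X : Matrix (Fin n) (Fin n) ℝ) (hX : X.IsHermitian) :
    (1 + X).det = ∏ i, (1 + hX.eigenvalues i) ∧ X.trace = ∑ i, hX.eigenvalues i ∧
    (X * X).trace = ∑ i, hX.eigenvalues i ^ 2 := by
  have h := hX.spectral_theorem
  set U := hX.eigenvectorUnitary
  set D : Matrix (Fin n) (Fin n) ℝ := diagonal (RCLike.ofReal ∘ hX.eigenvalues) with hD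
  have hu : (star (U : Matrix (Fin n) (Fin n) ℝ)) * (U : Matrix (Fin n) (Fin n) ℝ) = 1 := by
    simp
  have hu' : (U : Matrix (Fin n) (Fin n) ℝ) * star (U : Matrix (Fin n) (Fin n) ℝ) = 1 := by
    simp
  have h2 : X = (U : Matrix (Fin n) (Fin n) ℝ) * D * star (U : Matrix (Fin n) (Fin n) ℝ) := by
    rw [h]; simp [Unitary.conjStarAlgAut_apply]
  refine ⟨?_, ?_, ?_⟩
  · have : 1 + X = (U : Matrix (Fin n) (Fin n) ℝ) * (1 + D) * star (U : Matrix (Fin n) (Fin n) ℝ) := by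
      rw [mul_add, add_mul, ← h2, mul_one, hu']
    rw [this, det_mul_right_comm, hu', one_mul, hD, ← diagonal_one, diagonal_add, det_diagonal]
    rfl
  · conv_lhs => rw [h2]
    rw [trace_mul_comm, ← mul_assoc, hu, one_mul, hD, trace_diagonal]; rfl
  · have : X * X = (U : Matrix (Fin n) (Fin n) ℝ) * (D * D) * star (U : Matrix (Fin n) (Fin n) ℝ) := by
      conv_lhs => rw [h2]
      calc _ = (U : Matrix (Fin n) (Fin n) ℝ) * D * (star (U : Matrix (Fin n) (Fin n) ℝ) * U) * D * star (U : Matrix (Fin n) (Fin n) ℝ) := by simp only [mul_assoc]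
        _ = _ := by rw [hu]; simp only [mul_assoc, mul_one]
    rw [this, trace_mul_comm, ← mul_assoc, hu, one_mul, hD, diagonal_mul_diagonal, trace_diagonal]
    simp [sq]

open Matrix in
lemma aux_det {n : ℕ} (A G : Matrix (Fin n) (Fin n) ℝ) (hA : A.PosSemidef) (hAG : A * G = 1)
    (hG : ∀ i j, G i j = G j i) (e : Fin n → ℝ) (s : ℝ) (hs : ∑ i, ∑ j, G i j ^ 2 * (e i * e j) = s)
    (hs4 : s ≤ 1/4) :
    0 < (A + diagonal e).det / A.det ∧ 0 ≤ s ∧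
    |Real.log ((A + diagonal e).det / A.det) - ∑ i, G i i * e i + s/2| ≤ 2 * (s * Real.sqrt s) := by
  obtain ⟨B, hB⟩ : ∃ B : Matrix (Fin n) (Fin n) ℝ, A = Bᴴ * B := by
    open scoped MatrixOrder in
    obtain ⟨B, hB⟩ := CStarAlgebra.nonneg_iff_eq_star_mul_self.mp hA.nonneg
    exact ⟨B, hB⟩
  have hAu : IsUnit A.det := by
    rw [← Matrix.isUnit_iff_isUnit_det]
    exact IsUnit.of_mul_eq_one _ hAG
  have hA0 : A.det ≠ 0 := hAu.ne_zero
  have hBB : A.det = B.det * B.det := by rw [hB]; simp [conjTranspose_eq_transpose_of_trivial]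
  have hB0 : B.det ≠ 0 := by intro h; rw [h] at hBB; simp at hBB; exact hA0 hBB
  have hBu : IsUnit B.det := isUnit_iff_ne_zero.mpr hB0
  have hBtu : IsUnit Bᵀ.det := by rwa [det_transpose]
  rw [conjTranspose_eq_transpose_of_trivial] at hB
  set E := diagonal e with hE
  set X := (B⁻¹)ᵀ * E * B⁻¹ with hXd
  have hX : X.IsHermitian := by
    rw [IsHermitian, conjTranspose_eq_transpose_of_trivial, hXd, transpose_mul, transpose_mul,
      transpose_transpose, hE, diagonal_transpose, mul_assoc]
  have b1 : B⁻¹ * B = 1 := nonsing_inv_mul _ hBu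
  have b2 : Bᵀ * (B⁻¹)ᵀ = 1 := by rw [← transpose_mul, b1, transpose_one]
  have hGe : G = B⁻¹ * (B⁻¹)ᵀ := by
    have h1 : G = A⁻¹ := (inv_eq_right_inv hAG).symm
    rw [h1, hB, Matrix.mul_inv_rev, transpose_nonsing_inv]
  have hAE : A + E = Bᵀ * (1 + X) * B := by
    rw [mul_add, add_mul, mul_one, ← hB, hXd]
    congr 1
    calc E = (Bᵀ * (B⁻¹)ᵀ) * E * (B⁻¹ * B) := by rw [b1, b2]; simp
      _ = _ := by simp only [mul_assoc]
  have hdet : (A + E).det / A.det = (1 + X).det := by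
    rw [hAE, hBB]; simp; field_simp
  have htr : X.trace = ∑ i, G i i * e i := by
    rw [hXd, mul_assoc, trace_mul_comm, mul_assoc, ← hGe, trace_mul_comm, trace]
    simp [hE]
  have htr2 : (X * X).trace = s := by
    have : (X * X).trace = (G * E * (G * E)).trace := by
      rw [hXd, hGe]
      rw [show (B⁻¹)ᵀ * E * B⁻¹ * ((B⁻¹)ᵀ * E * B⁻¹) = ((B⁻¹)ᵀ * E * B⁻¹ * ((B⁻¹)ᵀ * E)) * B⁻¹ by simp only [mul_assoc], trace_mul_comm]
      simp only [mul_assoc]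
    rw [this, trace, ← hs]
    apply Finset.sum_congr rfl
    intro i _
    rw [diag_apply, Matrix.mul_apply]
    apply Finset.sum_congr rfl
    intro j _
    simp only [hE, mul_diagonal]
    rw [hG j i]; ring
  obtain ⟨h1, h2, h3⟩ := aux_herm X hX
  have hh := aux_prod hX.eigenvalues s (by rw [← h3, htr2]) hs4
  rw [hdet, h1, ← htr, h2]
  refine ⟨hh.1, ?_, hh.2⟩
  rw [← htr2, h3]; positivity

open Matrix in
def Tri (n : ℕ) (α : ℝ) : Matrix (Fin n) (Fin n) ℝ :=
  Matrix.of fun (i j : Fin n) =>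
    (if i = j then α else 0)
      - (if (i : ℕ) = (j : ℕ) + 1 ∨ (j : ℕ) = (i : ℕ) + 1 then 1 else 0)

open Matrix in
lemma Tri_psd (n : ℕ) (α : ℝ) (h : 2 ≤ α) : (Tri n α).PosSemidef := by
  let B : Matrix (Fin (n+1)) (Fin n) ℝ := Matrix.of fun l i =>
    (if l = i.castSucc then 1 else 0) - (if l = i.succ then 1 else 0)
  have : Tri n α = (α - 2) • (1 : Matrix (Fin n) (Fin n) ℝ) + Bᴴ * B := by
    ext i j
    simp only [Tri, B, Matrix.mul_apply, Matrix.of_apply, conjTranspose_apply, Matrix.add_apply, Matrix.smul_apply,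
      Matrix.one_apply, sub_mul, mul_sub, Finset.sum_sub_distrib, star_trivial, ite_mul, mul_ite, one_mul, mul_one, zero_mul, mul_zero, Finset.sum_ite_eq, Finset.sum_ite_eq', Finset.mem_univ, if_true, smul_eq_mul]
    simp only [Fin.ext_iff, Fin.val_castSucc, Fin.val_succ]
    split_ifs <;> first | omega | (norm_num; try linarith)
  rw [this]
  exact (PosSemidef.one.smul (by linarith)).add (posSemidef_conjTranspose_mul_self B)

open Matrix in
lemma Tri_inv (n : ℕ) (α : ℝ) (U : ℕ → ℝ) (h0 : U 0 = 0) (h1 : U 1 = 1)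
    (hr : ∀ x, U (x+2) = α * U (x+1) - U x) (hN : U (n+1) ≠ 0) :
    Tri n α * (Matrix.of fun i j : Fin n => U (min (i:ℕ) j + 1) * U (n - max (i:ℕ) j) / U (n+1)) = 1 := by
  have hW : ∀ j, j ≤ n → U (j+1) * U (n+1-j) - U j * U (n-j) = U (n+1) := by
    intro j
    induction j with
    | zero => intro _; simp [h0, h1]
    | succ j ih =>
      intro hj
      have := ih (by omega)
      obtain ⟨m, rfl⟩ : ∃ m, n = j + 1 + m := ⟨n - (j+1), by omega⟩
      rw [show j + 1 + m + 1 - j = m + 2 by omega, show j+1+m-j = m+1 by omega] at this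
      rw [show j + 1 + m + 1 - (j+1) = m + 1 by omega, show j+1+m-(j+1) = m by omega, ← this, hr, hr]
      ring
  have key : ∀ (g : ℕ → ℝ), g 0 = 0 → g (n+1) = 0 → ∀ i : Fin n,
      ∑ l : Fin n, Tri n α i l * g (l+1) = α * g (i+1) - g i - g (i+2) := by
    intro g g0 gn i
    have e : ∀ l : Fin n, Tri n α i l * g (l+1) = (if i = l then α * g (l+1) else 0)
       - (if (l:ℕ) + 1 = i then g (l+1) else 0) - (if (l:ℕ) = i + 1 then g (l + 1) else 0) := by
      intro l
      simp only [Tri, Matrix.of_apply]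
      split_ifs <;> first | omega | ring
    simp only [e, Finset.sum_sub_distrib]
    rw [Finset.sum_ite_eq]
    simp only [Finset.mem_univ, if_true]
    congr 1
    · congr 1
      rcases Nat.eq_zero_or_pos (i:ℕ) with hi | hi
      · rw [hi, g0]; simp
      · rw [Finset.sum_eq_single ⟨i - 1, by omega⟩]
        · rw [if_pos (by simp; omega)]; congr 1; simp; omega
        · intro l _ hl
          rw [if_neg]; intro h; apply hl; ext; simp; omega
        · simp
    · by_cases hi : (i:ℕ) + 1 < n
      · rw [Finset.sum_eq_single ⟨i + 1, hi⟩]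
        · simp
        · intro l _ hl
          rw [if_neg]; intro h; apply hl; ext; simp; omega
        · simp
      · rw [show (i:ℕ) + 2 = n + 1 by omega, gn]
        apply Finset.sum_eq_zero
        intro l _
        rw [if_neg]; omega
  ext i j
  rw [Matrix.mul_apply]
  have := key (fun x => U (min x (j+1)) * U (n + 1 - max x (j+1)) / U (n+1)) (by simp [h0])
    (by have : n + 1 - max (n+1) ((j:ℕ)+1) = 0 := by omega
        simp [this, h0]) i
  have e : ∀ l : Fin n, (Matrix.of fun i j : Fin n => U (min (i:ℕ) j + 1) * U (n - max (i:ℕ) j) / U (n+1)) l j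
     = U (min ((l:ℕ)+1) (j+1)) * U (n + 1 - max ((l:ℕ)+1) (j+1)) / U (n+1) := by
    intro l
    rw [Matrix.of_apply, show min ((l:ℕ)+1) (j+1) = min (l:ℕ) j + 1 by omega,
      show n + 1 - max ((l:ℕ)+1) (j+1) = n - max (l:ℕ) j by omega]
  simp only [e]
  rw [this]
  have hj := j.2
  have hi := i.2
  rw [Matrix.one_apply]
  rcases lt_trichotomy (i:ℕ) j with h | h | h
  · rw [if_neg (by rw [Fin.ext_iff]; omega)]
    rw [show min ((i:ℕ)+1) (j+1) = i + 1 by omega, show max ((i:ℕ)+1) (j+1) = j+1 by omega,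
      show min ((i:ℕ)+2) (j+1) = i + 2 by omega, show max ((i:ℕ)+2) (j+1) = j+1 by omega,
      show min ((i:ℕ)) (j+1) = i by omega, show max ((i:ℕ)) (j+1) = j+1 by omega, hr]
    ring
  · have hij : i = j := Fin.ext h
    subst hij
    rw [if_pos rfl]
    simp only [min_self, max_self]
    rw [show min ((i:ℕ)+2) (i+1) = i + 1 by omega, show max ((i:ℕ)+2) (i+1) = i+2 by omega,
      show min ((i:ℕ)) (i+1) = i by omega, show max ((i:ℕ)) (i+1) = i+1 by omega]
    have := hW i (by omega)
    obtain ⟨m, hm⟩ : ∃ m, n = i + 1 + m := ⟨n - (i+1), by omega⟩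
    rw [show n + 1 - i = m + 2 by omega, show n - i = m + 1 by omega] at this
    rw [show n + 1 - (i+1) = m + 1 by omega, show n + 1 - (i+2) = m by omega]
    field_simp
    rw [← this, hr]
    ring
  · rw [if_neg (by rw [Fin.ext_iff]; omega)]
    obtain ⟨m, hm⟩ : ∃ m, n = i + 1 + m := ⟨n - (i+1), by omega⟩
    rw [show min ((i:ℕ)+1) (j+1) = j + 1 by omega, show max ((i:ℕ)+1) (j+1) = i+1 by omega,
      show min ((i:ℕ)+2) (j+1) = j + 1 by omega, show max ((i:ℕ)+2) (j+1) = i+2 by omega,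
      show min ((i:ℕ)) (j+1) = j + 1 by omega, show max ((i:ℕ)) (j+1) = i by omega]
    rw [show n + 1 - (i+1) = m + 1 by omega, show n + 1 - (i+2) = m by omega, show n + 1 - i = m + 2 by omega, hr]
    ring


def dd (i j : ℕ) : ℕ := max i j - min i j

lemma geo_le' (q : ℝ) (h0 : 0 < q) (h1 : q < 1) (n : ℕ) : ∑ i ∈ Finset.range n, q ^ i ≤ 1 / (1 - q) := by
  rw [le_div_iff₀ (by linarith), geom_sum_mul_neg]
  have : 0 < q ^ n := by positivity
  linarith

lemma sum_r (q : ℝ) (h0 : 0 < q) (h1 : q < 1) (n : ℕ) : ∑ i : Fin n, q ^ ((i:ℕ) + 1) ≤ 1 / (1 - q) := by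
  rw [Fin.sum_univ_eq_sum_range (fun i => q ^ (i+1)) n]
  refine le_trans (Finset.sum_le_sum fun i _ => ?_) (geo_le' q h0 h1 n)
  exact pow_le_pow_of_le_one h0.le h1.le (by omega)

lemma sum_t (q : ℝ) (h0 : 0 < q) (h1 : q < 1) (n : ℕ) : ∑ i : Fin n, q ^ (n - (i:ℕ)) ≤ 1 / (1 - q) := by
  rw [Fin.sum_univ_eq_sum_range (fun i => q ^ (n - i)) n, ← Finset.sum_range_reflect]
  refine le_trans (Finset.sum_le_sum fun i hi => ?_) (geo_le' q h0 h1 n)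
  rw [Finset.mem_range] at hi
  exact pow_le_pow_of_le_one h0.le h1.le (by omega)

lemma sum_dd (x : ℝ) (j m : ℕ) :
    (∑ i ∈ Finset.range (j + 1 + m), x ^ (dd i j)) * (1 - x) = 1 + x - x ^ (j+1) - x ^ (m + 1) := by
  induction m with
  | zero =>
    have : ∀ i ∈ Finset.range (j+1), x ^ dd i j = x ^ (j + 1 - 1 - i) := by
      intro i hi
      rw [Finset.mem_range] at hi
      congr 1; unfold dd; omega
    rw [add_zero, Finset.sum_congr rfl this, Finset.sum_range_reflect (fun i => x ^ i), geom_sum_mul_neg]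
    ring
  | succ m ih =>
    rw [← add_assoc, Finset.sum_range_succ, add_mul, ih]
    have : dd (j+1+m) j = m + 1 := by unfold dd; omega
    rw [this]; ring

lemma sum_dd' (q : ℝ) (h0 : 0 < q) (h1 : q < 1) (n : ℕ) (j : Fin n) :
    ∑ i : Fin n, (q ^ (dd i j))^2 = (1 + q^2 - (q ^ ((j:ℕ)+1))^2 - (q ^ (n - (j:ℕ)))^2) / (1 - q^2) := by
  have h : 1 - q^2 ≠ 0 := by nlinarith
  rw [eq_div_iff h]
  have hj := j.2
  have := sum_dd (q^2) j (n - 1 - j)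
  rw [show (j:ℕ) + 1 + (n - 1 - j) = n by omega, show n - 1 - (j:ℕ) + 1 = n - j by omega] at this
  rw [Fin.sum_univ_eq_sum_range (fun i => (q ^ dd i j)^2) n]
  simp only [← pow_mul, mul_comm _ 2] at this ⊢
  exact this

lemma dd_bound (q : ℝ) (h0 : 0 < q) (h1 : q < 1) (d : ℕ) : (d:ℝ) * q ^ d ≤ 1 / (1 - q) := by
  rw [le_div_iff₀ (by linarith)]
  have hB := one_add_mul_le_pow (a := q⁻¹ - 1) (by have : 0 < q⁻¹ := by positivity
                                                   linarith) d
  have h2 : 1 - q ≤ q⁻¹ - 1 := by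
    have : q * q⁻¹ = 1 := mul_inv_cancel₀ h0.ne'
    nlinarith [sq_nonneg (1 - q), inv_pos.mpr h0]
  have h3 : (d:ℝ) * (1 - q) ≤ (q⁻¹)^d := by
    have : (d:ℝ) * (1-q) ≤ d * (q⁻¹ - 1) := by gcongr
    simp only [add_sub_cancel] at hB
    linarith
  have h4 : (q⁻¹)^d * q^d = 1 := by rw [← mul_pow, inv_mul_cancel₀ h0.ne', one_pow]
  have : 0 < q^d := by positivity
  nlinarith

structure GB (n : ℕ) (q : ℝ) (G : Fin n → Fin n → ℝ) : Prop where
  nonneg : ∀ i j, 0 ≤ G i j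
  le : ∀ i j : Fin n, G i j ≤ q ^ (dd i j) / (q⁻¹ - q)
  diff : ∀ i j : Fin n, q ^ (dd i j) / (q⁻¹ - q) - G i j ≤
    4/3 * (q ^ ((i:ℕ)+1) * q ^ ((j:ℕ)+1) + q ^ (n - (i:ℕ)) * q ^ (n - (j:ℕ))) / (q⁻¹ - q)

lemma w_ge (q : ℝ) (h0 : 0 < q) (h1 : q < 1) : 1 - q ≤ q⁻¹ - q := by
  have : 1 ≤ q⁻¹ := (one_le_inv₀ h0).mpr h1.le
  linarith

lemma sumG2 {n : ℕ} {q : ℝ} (h0 : 0 < q) (h1 : q < 1) {G : Fin n → Fin n → ℝ} (hG : GB n q G) (j : Fin n) :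
    ∑ i, G i j ^ 2 ≤ 2 / (1 - q)^3 := by
  have hd : 0 < 1 - q := by linarith
  have hw := w_ge q h0 h1
  calc ∑ i, G i j ^ 2 ≤ ∑ i : Fin n, (q ^ (dd i j))^2 / (1-q)^2 := by
        apply Finset.sum_le_sum
        intro i _
        rw [← div_pow]
        apply pow_le_pow_left₀ (hG.nonneg i j)
        refine (hG.le i j).trans ?_
        gcongr
    _ = (1 + q^2 - (q ^ ((j:ℕ)+1))^2 - (q ^ (n - (j:ℕ)))^2) / (1 - q^2) / (1-q)^2 := by
        rw [← Finset.sum_div, sum_dd' q h0 h1]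
    _ ≤ 2 / (1 - q) / (1-q)^2 := by
        gcongr
        · have := sq_nonneg (q ^ ((j:ℕ)+1))
          have := sq_nonneg (q ^ (n - (j:ℕ)))
          nlinarith
        · nlinarith
    _ = _ := by field_simp

lemma sumG2e {n : ℕ} {q : ℝ} (h0 : 0 < q) (h1 : q < 1) {G : Fin n → Fin n → ℝ} (hG : GB n q G)
    (e : Fin n → ℝ) (η : ℝ) (he : ∀ i, |e i| ≤ η) :
    |∑ i, ∑ j, G i j ^ 2 * (e i * e j)| ≤ η^2 * (n * (2 / (1-q)^3)) := by
  calc |∑ i, ∑ j, G i j ^ 2 * (e i * e j)| ≤ ∑ i, ∑ j, G i j ^ 2 * η^2 := by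
        refine (Finset.abs_sum_le_sum_abs _ _).trans (Finset.sum_le_sum fun i _ => ?_)
        refine (Finset.abs_sum_le_sum_abs _ _).trans (Finset.sum_le_sum fun j _ => ?_)
        rw [abs_mul, abs_mul, abs_of_nonneg (sq_nonneg (G i j)), sq η]
        have := (abs_nonneg _).trans (he i)
        gcongr
        · exact he i
        · exact he j
    _ = η^2 * ∑ j, ∑ i, G i j ^ 2 := by
        rw [Finset.sum_comm, Finset.mul_sum]
        simp only [Finset.mul_sum, mul_comm]
    _ ≤ η^2 * ∑ j : Fin n, 2 / (1-q)^3 := by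
        gcongr with j _
        exact sumG2 h0 h1 hG j
    _ = _ := by simp

lemma bulk (q a b2 : ℝ) (h0 : 0 < q) (h1 : q < 1) (ha : a = 4 - (q + q⁻¹)) (hb : b2 = 4 - a^2) :
    |a / (q⁻¹ - q) - b2 * (1 + q^2) / ((1-q^2) * (q⁻¹ - q)^2)| ≤ 4 := by
  have h2 : 0 < 1 - q := by linarith
  have h3 : 0 < 1 + q := by linarith
  have hw : q⁻¹ - q = (1-q)*(1+q)/q := by field_simp; ring
  have : a / (q⁻¹ - q) - b2 * (1 + q^2) / ((1-q^2) * (q⁻¹ - q)^2) = - (4 * (1-q) * q / (1+q)^3) := by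
    rw [hb, hw, show (1 - q^2) = (1-q)*(1+q) by ring, ha]
    field_simp
    ring
  rw [this, abs_neg, abs_of_nonneg (by positivity), div_le_iff₀ (by positivity)]
  have : 1 ≤ (1+q)^3 := one_le_pow₀ (by linarith)
  nlinarith

lemma b2_le (q a b2 : ℝ) (h0 : 1/6 ≤ q) (h1 : q < 1) (ha : a = 4 - (q + q⁻¹)) (hb : b2 = 4 - a^2) (ha2 : |a| ≤ 2) :
    0 ≤ b2 ∧ b2 ≤ 24 * (1-q)^2 := by
  have hq : 0 < q := by linarith
  have ha' := abs_le.mp ha2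
  have hm : 2 - a = (1-q)^2 / q := by rw [ha]; field_simp; ring
  have hm2 : 2 - a ≤ 6 * (1-q)^2 := by
    rw [hm, div_le_iff₀ hq]
    nlinarith [sq_nonneg (1-q)]
  constructor
  · rw [hb]; nlinarith
  · rw [hb]; nlinarith

lemma main_diag {n : ℕ} {q : ℝ} (h6 : 1/6 ≤ q) (h1 : q < 1) {G : Fin n → Fin n → ℝ} (hG : GB n q G)
    (a b2 : ℝ) (ha : a = 4 - (q + q⁻¹)) (hb : b2 = 4 - a^2) (ha2 : |a| ≤ 2) :
    ∑ j, |a * G j j - b2 * ∑ i, G i j ^ 2| ≤ 4 * n + 200 / (1-q)^2 := by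
  have h0 : 0 < q := by linarith
  have hd : 0 < 1 - q := by linarith
  have hw := w_ge q h0 h1
  have hw0 : 0 < q⁻¹ - q := by linarith
  obtain ⟨hb0, hb1⟩ := b2_le q a b2 h6 h1 ha hb ha2
  set r : Fin n → ℝ := fun i => q ^ ((i:ℕ)+1) with hr
  set t : Fin n → ℝ := fun i => q ^ (n - (i:ℕ)) with ht
  have r0 : ∀ i, 0 ≤ r i := fun i => by positivity
  have t0 : ∀ i, 0 ≤ t i := fun i => by positivity
  have r1 : ∀ i, r i ≤ 1 := fun i => pow_le_one₀ h0.le h1.le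
  have t1 : ∀ i, t i ≤ 1 := fun i => pow_le_one₀ h0.le h1.le
  have sr : ∑ i, r i ≤ 1 / (1-q) := sum_r q h0 h1 n
  have st : ∑ i, t i ≤ 1 / (1-q) := sum_t q h0 h1 n
  have sr0 : 0 ≤ ∑ i, r i := Finset.sum_nonneg fun i _ => r0 i
  have st0 : 0 ≤ ∑ i, t i := Finset.sum_nonneg fun i _ => t0 i
  have sr2 : ∑ i, r i * r i ≤ 1 / (1-q) := le_trans (Finset.sum_le_sum fun i _ => by
    nlinarith [r0 i, r1 i]) sr
  have st2 : ∑ i, t i * t i ≤ 1 / (1-q) := le_trans (Finset.sum_le_sum fun i _ => by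
    nlinarith [t0 i, t1 i]) st
  set B : Fin n → Fin n → ℝ := fun i j => q ^ (dd i j) / (q⁻¹ - q) with hB
  have hB1 : ∀ i j, B i j ≤ 1 / (1-q) := fun i j => by
    have : q ^ (dd i j) ≤ 1 := pow_le_one₀ h0.le h1.le
    simp only [hB]; gcongr
  have hdf : ∀ i j, B i j - G i j ≤ 4/3 * (r i * r j + t i * t j) / (1-q) := fun i j => by
    refine (hG.diff i j).trans ?_
    have := r0 i; have := r0 j; have := t0 i; have := t0 j
    have h5 : 0 ≤ r i * r j + t i * t j := by positivity
    gcongr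
  have hdd : ∀ j : Fin n, B j j = 1 / (q⁻¹ - q) := fun j => by simp [hB, dd]
  have key : ∀ j, |a * G j j - b2 * ∑ i, G i j ^ 2| ≤ 4 + 8/3 * (r j * r j + t j * t j) / (1-q)
      + 64 * ∑ i, (r i * r j + t i * t j) + 24 * (r j * r j + t j * t j) / (1-q) := by
    intro j
    have e1 : a * G j j - b2 * ∑ i, G i j ^ 2 =
       (a / (q⁻¹ - q) - b2 * (1 + q^2) / ((1-q^2) * (q⁻¹ - q)^2)) - a * (B j j - G j j)
       + b2 * ∑ i, (B i j ^ 2 - G i j ^ 2) + b2 * (r j * r j + t j * t j) / ((1-q^2) * (q⁻¹ - q)^2) := by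
      have : ∑ i, B i j ^ 2 = (1 + q^2 - (r j)^2 - (t j)^2) / (1 - q^2) / (q⁻¹ - q)^2 := by
        simp only [hB, div_pow]
        rw [← Finset.sum_div, sum_dd' q h0 h1]
      rw [Finset.sum_sub_distrib, this, hdd]
      have : (1 - q^2) ≠ 0 := by nlinarith
      field_simp
      ring
    have f2 : |a * (B j j - G j j)| ≤ 8/3 * (r j * r j + t j * t j) / (1-q) := by
      rw [abs_mul, abs_of_nonneg (sub_nonneg.mpr (hG.le j j))]
      calc |a| * (B j j - G j j) ≤ 2 * (4/3 * (r j * r j + t j * t j) / (1-q)) := by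
            apply mul_le_mul ha2 (hdf j j) (sub_nonneg.mpr (hG.le j j)) (by norm_num)
        _ = _ := by ring
    have f3 : |b2 * ∑ i, (B i j ^ 2 - G i j ^ 2)| ≤ 64 * ∑ i, (r i * r j + t i * t j) := by
      rw [abs_mul, abs_of_nonneg hb0]
      calc b2 * |∑ i, (B i j ^ 2 - G i j ^ 2)| ≤ 24 * (1-q)^2 * ∑ i, (8/3 * (r i * r j + t i * t j) / (1-q)^2) := by
            gcongr
            refine (Finset.abs_sum_le_sum_abs _ _).trans (Finset.sum_le_sum fun i _ => ?_)
            have g0 := hG.nonneg i j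
            have g1 : G i j ≤ B i j := hG.le i j
            rw [abs_of_nonneg (by nlinarith)]
            calc B i j ^ 2 - G i j ^ 2 = (B i j + G i j) * (B i j - G i j) := by ring
              _ ≤ (2 * (1/(1-q))) * (4/3 * (r i * r j + t i * t j) / (1-q)) := by
                  apply mul_le_mul _ (hdf i j) (by linarith) (by positivity)
                  linarith [hB1 i j]
              _ = _ := by field_simp; ring
        _ = _ := by
            rw [← Finset.sum_div, ← Finset.mul_sum]
            generalize ∑ i, (r i * r j + t i * t j) = Z
            field_simp; ring
    have f4 : |b2 * (r j * r j + t j * t j) / ((1-q^2) * (q⁻¹ - q)^2)| ≤ 24 * (r j * r j + t j * t j) / (1-q) := by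
      have h5 : 0 ≤ r j * r j + t j * t j := by nlinarith
      have h6 : 1 - q ≤ 1 - q^2 := by nlinarith
      have h7 : 0 < 1 - q^2 := by linarith
      rw [abs_of_nonneg (by positivity)]
      calc b2 * (r j * r j + t j * t j) / ((1-q^2) * (q⁻¹ - q)^2) ≤ (24 * (1-q)^2) * (r j * r j + t j * t j) / ((1-q) * (1 - q)^2) := by
            gcongr
        _ = _ := by field_simp
    have f1 := bulk q a b2 h0 h1 ha hb
    rw [e1]
    refine (abs_add_le _ _).trans (add_le_add ((abs_add_le _ _).trans (add_le_add ((abs_sub _ _).trans (add_le_add f1 f2)) f3)) f4)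
  have s1 : ∑ j, (r j * r j + t j * t j) ≤ 2 / (1-q) := by
    rw [Finset.sum_add_distrib]
    calc _ ≤ 1/(1-q) + 1/(1-q) := add_le_add sr2 st2
      _ = _ := by ring
  have s2 : ∑ j, ∑ i, (r i * r j + t i * t j) ≤ 2 / (1-q)^2 := by
    have : ∑ j, ∑ i, (r i * r j + t i * t j) = (∑ i, r i) * (∑ i, r i) + (∑ i, t i) * (∑ i, t i) := by
      simp only [Finset.sum_add_distrib, Finset.sum_mul_sum]
      rw [Finset.sum_comm, Finset.sum_comm (f := fun j i => t i * t j)]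
    rw [this]
    calc _ ≤ 1/(1-q) * (1/(1-q)) + 1/(1-q) * (1/(1-q)) := by gcongr
      _ = _ := by field_simp; norm_num
  refine (Finset.sum_le_sum fun j _ => key j).trans ?_
  simp only [Finset.sum_add_distrib, ← Finset.sum_div, ← Finset.mul_sum] at s1 s2 ⊢
  simp only [Finset.sum_const, Finset.card_univ, Fintype.card_fin, nsmul_eq_mul]
  set Z := ∑ j, r j * r j + ∑ j, t j * t j
  have z1 : 8/3 * Z / (1-q) ≤ 8/3 * (2/(1-q)) / (1-q) := by gcongr
  have z2 : 24 * Z / (1-q) ≤ 24 * (2/(1-q)) / (1-q) := by gcongr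
  have z3 : (8/3 * (2/(1-q)) / (1-q) + 24 * (2/(1-q)) / (1-q)) + 64 * (2/(1-q)^2) ≤ 200/(1-q)^2 := by
    have : (8/3 * (2/(1-q)) / (1-q) + 24 * (2/(1-q)) / (1-q)) + 64 * (2/(1-q)^2) = (8/3*2+48+128)/(1-q)^2 := by
      field_simp; norm_num
    rw [this]
    gcongr; norm_num
  linarith


lemma core_num (n δ c κ : ℝ) (hd : 0 < δ) (hd1 : δ ≤ 1) (hn : 1 ≤ n) (hκ : 1 ≤ κ) (hκn : κ ≤ n * δ)
    (hc0 : 0 < c) (hc1 : c ≤ 1) :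
    c^2/n^2 * (4 * n + 200 / δ^2) + 2 * (n * (1/δ * (c^2 / (2 * n^2))^2)) + 12 * δ^2 * (n * (n * ((c/n^2)^2 * (1/δ^4)))) + 4 * ((c^2/(2*n^2))^2 * (n * (2 / δ^3))) ≤ 300 * c^2 / κ^2 + 4 * c^2 / n := by
  have hn0 : 0 < n := by linarith
  obtain ⟨y, hy⟩ : ∃ y, y = n * δ := ⟨_, rfl⟩
  have hq : δ = y / n := by rw [hy]; field_simp
  have hy1 : 1 ≤ y := by linarith
  have hy0 : 0 < y := by linarith
  have hyn : y ≤ n := by rw [hy]; nlinarith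
  have hκy : κ ≤ y := by linarith
  have e5 : c^2/n^2 * (4 * n + 200 / δ^2) + 2 * (n * (1/δ * (c^2 / (2 * n^2))^2)) + 12 * δ^2 * (n * (n * ((c/n^2)^2 * (1/δ^4)))) + 4 * ((c^2/(2*n^2))^2 * (n * (2 / δ^3)))
     = 4 * c^2/n + 212 * (c^2 / y^2) + c^4 / (2 * n^2 * y) + 2 * c^4 / y^3 := by
    rw [hq]; field_simp; ring
  rw [e5]
  have hc4 : c^4 ≤ c^2 := pow_le_pow_of_le_one hc0.le hc1 (by norm_num)
  have u1 : c^4 / (2 * n^2 * y) ≤ c^2 / y^2 := by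
    have h1 : y * 1 ≤ n * n := by gcongr
    have : y^2 ≤ 2 * n^2 * y := by nlinarith
    gcongr
  have u2 : 2 * c^4 / y^3 ≤ 2 * (c^2 / y^2) := by
    rw [mul_div_assoc]
    have : y^2 ≤ y^3 := pow_le_pow_right₀ hy1 (by norm_num)
    gcongr
  have u3 : c^2 / y^2 ≤ c^2 / κ^2 := by gcongr
  have u4 : 0 ≤ c^2 / κ^2 := by positivity
  have : 300 * c^2 / κ^2 = 300 * (c^2/κ^2) := by ring
  rw [this]
  linarith

lemma core {n : ℕ} {q : ℝ} (h6 : 1/6 ≤ q) (h1 : q < 1) {G : Fin n → Fin n → ℝ} (hG : GB n q G)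
    (hGs : ∀ i j, G i j = G j i)
    (a b2 κ c : ℝ) (ha : a = 4 - (q + q⁻¹)) (hb : b2 = 4 - a^2) (ha2 : |a| ≤ 2)
    (hn : 1 ≤ n) (hκ : 1 ≤ κ) (hκn : κ ≤ n * (1-q)) (hc0 : 0 < c) (hc1 : c ≤ 1)
    (S D : Fin n → ℝ) (hD : ∀ i, |D i| ≤ c / n) (hS0 : ∀ i, 0 ≤ S i) (hS : ∀ i, S i ≤ c^2 / (2 * n^2))
    (hSD : ∀ i, 2 * S i = D i ^ 2 + S i ^ 2) (hDD : ∀ i j : Fin n, |D i - D j| ≤ c / n^2 * (dd i j : ℝ)) :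
    |2 * a * ∑ j, G j j * S j - a^2 * ∑ i, ∑ j, G i j ^ 2 * (S i * S j)
      - b2 * ∑ i, ∑ j, G i j ^ 2 * (D i * D j)| ≤ 300 * c^2 / κ^2 + 4 * c^2 / n := by
  have h0 : 0 < q := by linarith
  have hd : 0 < 1 - q := by linarith
  have hw := w_ge q h0 h1
  have hw0 : 0 < q⁻¹ - q := by linarith
  have hn0 : (1:ℝ) ≤ n := by exact_mod_cast hn
  have hn00 : (0:ℝ) < n := by linarith
  obtain ⟨hb0, hb1⟩ := b2_le q a b2 h6 h1 ha hb ha2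
  have hG1 : ∀ i j, G i j ≤ 1 / (1-q) := fun i j => by
    have : q ^ (dd i j) ≤ 1 := pow_le_one₀ h0.le h1.le
    refine (hG.le i j).trans ?_
    gcongr
  have e : 2 * a * ∑ j, G j j * S j - a^2 * ∑ i, ∑ j, G i j ^ 2 * (S i * S j)
      - b2 * ∑ i, ∑ j, G i j ^ 2 * (D i * D j)
      = ∑ j, D j ^ 2 * (a * G j j - b2 * ∑ i, G i j ^ 2) + a * ∑ j, G j j * S j ^ 2
        + b2 / 2 * ∑ i, ∑ j, G i j ^ 2 * (D i - D j)^2 - a^2 * ∑ i, ∑ j, G i j ^ 2 * (S i * S j) := by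
    have e1 : 2 * a * ∑ j, G j j * S j = a * ∑ j, G j j * D j ^ 2 + a * ∑ j, G j j * S j ^ 2 := by
      rw [← mul_add, ← Finset.sum_add_distrib, mul_comm 2 a, mul_assoc]
      congr 1
      rw [Finset.mul_sum]
      apply Finset.sum_congr rfl
      intro j _
      rw [← mul_add, ← hSD]; ring
    have e2 : ∑ i, ∑ j, G i j ^ 2 * (D i - D j)^2 = 2 * ∑ j, D j ^ 2 * ∑ i, G i j ^ 2
        - 2 * ∑ i, ∑ j, G i j ^ 2 * (D i * D j) := by
      have : ∀ i j, G i j ^ 2 * (D i - D j)^2 = D j ^ 2 * G i j ^ 2 + D i ^ 2 * G j i ^ 2 - 2 * (G i j ^ 2 * (D i * D j)) := by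
        intro i j; rw [hGs j i]; ring
      simp only [this, Finset.sum_sub_distrib, Finset.sum_add_distrib, ← Finset.mul_sum]
      rw [Finset.sum_comm]
      simp only [← Finset.mul_sum]
      ring
    have e3 : ∑ j, D j ^ 2 * (a * G j j - b2 * ∑ i, G i j ^ 2) = a * ∑ j, G j j * D j ^ 2 - b2 * ∑ j, D j ^ 2 * ∑ i, G i j ^ 2 := by
      rw [Finset.mul_sum, Finset.mul_sum, ← Finset.sum_sub_distrib]
      apply Finset.sum_congr rfl
      intro j _; ring
    rw [e1, e2, e3]; ring
  have hDsq : ∀ j, D j ^ 2 ≤ c^2 / n^2 := fun j => by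
    rw [← div_pow]; exact sq_le_sq' (by linarith [(abs_le.mp (hD j)).1]) (abs_le.mp (hD j)).2
  have t1 : |∑ j, D j ^ 2 * (a * G j j - b2 * ∑ i, G i j ^ 2)| ≤ c^2/n^2 * (4 * n + 200 / (1-q)^2) := by
    refine le_trans ?_ (mul_le_mul_of_nonneg_left (main_diag h6 h1 hG a b2 ha hb ha2) (by positivity))
    rw [Finset.mul_sum]
    refine (Finset.abs_sum_le_sum_abs _ _).trans (Finset.sum_le_sum fun j _ => ?_)
    rw [abs_mul, abs_of_nonneg (sq_nonneg (D j))]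
    exact mul_le_mul_of_nonneg_right (hDsq j) (abs_nonneg _)
  have t2 : |a * ∑ j, G j j * S j ^ 2| ≤ 2 * (n * (1/(1-q) * (c^2 / (2 * n^2))^2)) := by
    rw [abs_mul]
    refine mul_le_mul ha2 ?_ (abs_nonneg _) (by norm_num)
    have : (n * (1/(1-q) * (c^2 / (2 * n^2))^2)) = ∑ j : Fin n, (1/(1-q) * (c^2 / (2 * n^2))^2) := by simp
    rw [this]
    refine (Finset.abs_sum_le_sum_abs _ _).trans (Finset.sum_le_sum fun j _ => ?_)
    have := hG.nonneg j j
    rw [abs_of_nonneg (by positivity)]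
    have := hS j; have := hS0 j; have := hG1 j j
    gcongr
  have t3 : |b2 / 2 * ∑ i, ∑ j, G i j ^ 2 * (D i - D j)^2| ≤ 12 * (1-q)^2 * (n * (n * ((c/n^2)^2 * (1/(1-q)^4)))) := by
    rw [abs_mul, abs_of_nonneg (by positivity : 0 ≤ b2/2)]
    refine mul_le_mul (by linarith) ?_ (abs_nonneg _) (by positivity)
    have : (n * (n * ((c/n^2)^2 * (1/(1-q)^4)))) = ∑ i : Fin n, ∑ j : Fin n, ((c/n^2)^2 * (1/(1-q)^4)) := by simp
    rw [this]
    refine (Finset.abs_sum_le_sum_abs _ _).trans (Finset.sum_le_sum fun i _ => ?_)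
    refine (Finset.abs_sum_le_sum_abs _ _).trans (Finset.sum_le_sum fun j _ => ?_)
    rw [abs_of_nonneg (by positivity), ← mul_pow, ← sq_abs]
    have : (c/n^2)^2 * (1/(1-q)^4) = (c/n^2 * (1/(1-q) * (1/(1-q))))^2 := by field_simp
    rw [this]
    apply pow_le_pow_left₀ (abs_nonneg _)
    rw [abs_mul, abs_of_nonneg (hG.nonneg i j)]
    calc G i j * |D i - D j| ≤ (q ^ (dd i j) / (1-q)) * (c / n^2 * (dd i j : ℝ)) := by
          refine mul_le_mul ((hG.le i j).trans ?_) (hDD i j) (abs_nonneg _) (by positivity)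
          gcongr
      _ = c / n^2 * (1/(1-q) * ((dd i j : ℝ) * q ^ (dd i j))) := by ring
      _ ≤ _ := by
          have := dd_bound q h0 h1 (dd i j)
          gcongr
  have t4 : |a^2 * ∑ i, ∑ j, G i j ^ 2 * (S i * S j)| ≤ 4 * ((c^2/(2*n^2))^2 * (n * (2 / (1-q)^3))) := by
    rw [abs_mul, abs_of_nonneg (sq_nonneg a)]
    refine mul_le_mul ?_ (sumG2e h0 h1 hG S _ fun i => by rw [abs_of_nonneg (hS0 i)]; exact hS i) (abs_nonneg _) (by norm_num)
    rw [← sq_abs]; nlinarith [abs_nonneg a]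
  rw [e]
  refine ((abs_sub _ _).trans (add_le_add ((abs_add_le _ _).trans (add_le_add ((abs_add_le _ _).trans (add_le_add t1 t2)) t3)) t4)).trans ?_
  exact core_num n (1-q) c κ hd (by linarith) hn0 hκ hκn hc0 hc1

noncomputable def Uq (q : ℝ) (x : ℕ) : ℝ := (q⁻¹ ^ x - q ^ x) / (q⁻¹ - q)

lemma Uq_eq (q : ℝ) (h0 : 0 < q) (x : ℕ) : Uq q x = q⁻¹ ^ x * (1 - (q ^ x)^2) / (q⁻¹ - q) := by
  have : q⁻¹ ^ x * q ^ x = 1 := by rw [← mul_pow, inv_mul_cancel₀ h0.ne', one_pow]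
  unfold Uq
  congr 1
  linear_combination (q ^ x) * this

lemma GB_Uq (n : ℕ) (q : ℝ) (h0 : 0 < q) (h1 : q < 1) (hn : 1 ≤ n * (1-q)) :
    GB n q (fun i j : Fin n => Uq q (min (i:ℕ) j + 1) * Uq q (n - max (i:ℕ) j) / Uq q (n+1)) := by
  have hd : 0 < 1 - q := by linarith
  have hw0 : 0 < q⁻¹ - q := by linarith [w_ge q h0 h1]
  have hN : q ^ (n+1) ≤ 1/2 := by
    have := one_add_mul_le_pow (a := q⁻¹ - 1) (by have : 0 < q⁻¹ := by positivity
                                                  linarith) (n+1)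
    have h2 : 1 - q ≤ q⁻¹ - 1 := by
      have : q * q⁻¹ = 1 := mul_inv_cancel₀ h0.ne'
      nlinarith [sq_nonneg (1 - q), inv_pos.mpr h0]
    have h3 : (n:ℝ) * (1-q) ≤ n * (q⁻¹ - 1) := by gcongr
    push_cast at this
    simp only [add_sub_cancel] at this
    have h4 : 2 ≤ (q⁻¹)^(n+1) := by linarith
    have h5 : (q⁻¹)^(n+1) * q^(n+1) = 1 := by rw [← mul_pow, inv_mul_cancel₀ h0.ne', one_pow]
    have : 0 < q^(n+1) := by positivity
    nlinarith
  have hform : ∀ i j : Fin n, ∃ u v Q : ℝ, 0 ≤ u ∧ u ≤ 1 ∧ 0 ≤ v ∧ v ≤ 1 ∧ 0 ≤ Q ∧ Q ≤ 1/4 ∧ Q ≤ u * v ∧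
      Uq q (min (i:ℕ) j + 1) * Uq q (n - max (i:ℕ) j) / Uq q (n+1) =
        q ^ (dd i j) * ((1 - u) * (1 - v) / (1 - Q)) / (q⁻¹ - q) ∧
      q ^ (dd i j) * (u + v) = q ^ ((i:ℕ)+1) * q ^ ((j:ℕ)+1) + q ^ (n - (i:ℕ)) * q ^ (n - (j:ℕ)) := by
    intro i j
    have hi := i.2
    have hj := j.2
    refine ⟨(q ^ (min (i:ℕ) j + 1))^2, (q ^ (n - max (i:ℕ) j))^2, (q^(n+1))^2, by positivity, ?_, by positivity, ?_, by positivity, ?_, ?_, ?_, ?_⟩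
    · rw [← pow_mul]; exact pow_le_one₀ h0.le h1.le
    · rw [← pow_mul]; exact pow_le_one₀ h0.le h1.le
    · have : 0 < q^(n+1) := by positivity
      nlinarith
    · rw [← pow_mul, ← pow_mul, ← pow_mul, ← pow_add]
      apply pow_le_pow_of_le_one h0.le h1.le
      omega
    · rw [Uq_eq q h0, Uq_eq q h0, Uq_eq q h0]
      have hx : q⁻¹ ^ (n+1) * q ^ (dd i j) = q⁻¹ ^ (min (i:ℕ) j + 1) * q⁻¹ ^ (n - max (i:ℕ) j) := by
        rw [← pow_add, show n + 1 = (min (i:ℕ) j + 1 + (n - max (i:ℕ) j)) + dd i j by unfold dd; omega, pow_add, mul_assoc, ← mul_pow, inv_mul_cancel₀ h0.ne', one_pow, mul_one]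
      have hQ : 1 - (q^(n+1))^2 ≠ 0 := by
        have : 0 < q^(n+1) := by positivity
        nlinarith
      have hp : q⁻¹ ^ (n+1) ≠ 0 := by positivity
      rw [div_mul_div_comm, div_div_div_eq, mul_div_assoc', div_eq_div_iff (by positivity) (by positivity)]
      rw [div_mul_eq_mul_div, eq_div_iff hQ]
      generalize q⁻¹ ^ (n+1) = P at *
      generalize q⁻¹ - q = w at *
      linear_combination (-(1 - (q ^ (min (i:ℕ) j + 1))^2) * (1 - (q ^ (n - max (i:ℕ) j))^2) * (1 - (q^(n+1))^2) * w^2) * hx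
    · rw [← pow_mul, ← pow_mul, mul_add, ← pow_add, ← pow_add, ← pow_add, ← pow_add]
      congr 2 <;> (unfold dd; omega)
  refine ⟨?_, ?_, ?_⟩
  · intro i j
    obtain ⟨u, v, Q, u0, u1, v0, v1, Q0, Q1, Quv, hf, -⟩ := hform i j
    beta_reduce
    rw [hf]
    have : 0 ≤ 1 - u := by linarith
    have : 0 ≤ 1 - v := by linarith
    have : 0 ≤ 1 - Q := by linarith
    positivity
  · intro i j
    obtain ⟨u, v, Q, u0, u1, v0, v1, Q0, Q1, Quv, hf, -⟩ := hform i j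
    beta_reduce
    rw [hf]
    have : (1 - u) * (1 - v) / (1 - Q) ≤ 1 := by
      rw [div_le_one (by linarith)]
      nlinarith
    have h2 : 0 ≤ q ^ (dd i j) := by positivity
    gcongr
    nlinarith
  · intro i j
    obtain ⟨u, v, Q, u0, u1, v0, v1, Q0, Q1, Quv, hf, hg⟩ := hform i j
    beta_reduce
    rw [hf, ← hg, ← sub_div]
    have : 1 - 4/3 * (u+v) ≤ (1 - u) * (1 - v) / (1 - Q) := by
      rw [le_div_iff₀ (by linarith)]
      nlinarith [mul_nonneg u0 v0]
    have h2 : 0 ≤ q ^ (dd i j) := by positivity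
    gcongr
    nlinarith


def thet (n k : ℕ) : ℝ := 2 * Real.pi * k / n

open Matrix in
lemma M_eq (n k : ℕ) (φ : ℝ) : Mblock n k φ = Tri n (4 - 2 * Real.cos (thet n k)) +
    diagonal (fun i : Fin n => 2 * Real.cos (thet n k) * (1 - Real.cos (((i:ℕ)+1) * φ))
      + 2 * Real.sin (thet n k) * Real.sin (((i:ℕ)+1) * φ)) := by
  ext i j
  simp only [Mblock, Tri, Matrix.add_apply, Matrix.of_apply, diagonal_apply]
  by_cases h : i = j
  · simp only [h, if_true]
    rw [← thet, Real.cos_add]; ring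
  · simp only [h, if_false]; ring

lemma M_zero (n k : ℕ) : Mblock n k 0 = Tri n (4 - 2 * Real.cos (thet n k)) := by
  rw [M_eq]; simp

lemma M_refl (n k : ℕ) (φ : ℝ) (hn : 1 ≤ n) (hk : k ≤ n) : Mblock n (n - k) φ = Mblock n k (-φ) := by
  ext i j
  simp only [Mblock, Matrix.of_apply]
  have hn0 : (n:ℝ) ≠ 0 := by positivity
  have : Real.cos (2 * Real.pi * ((n - k : ℕ):ℝ) / n + ((i : ℕ) + 1) * φ)
      = Real.cos (2 * Real.pi * k / n + ((i : ℕ) + 1) * (-φ)) := by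
    rw [← Real.cos_neg, ← Real.cos_add_two_pi, Nat.cast_sub hk]
    congr 1
    field_simp
    ring
  rw [this]

lemma exists_q (a : ℝ) (h1 : a < 2) (h2 : -2 ≤ a) : ∃ q : ℝ, 1/6 ≤ q ∧ q < 1 ∧ a = 4 - (q + q⁻¹) := by
  set α := 4 - a with hα
  have h4 : 0 ≤ α^2 - 4 := by nlinarith
  set r := Real.sqrt (α^2 - 4) with hr
  have hrr : r^2 = α^2 - 4 := Real.sq_sqrt h4
  have hr0 : 0 ≤ r := Real.sqrt_nonneg _
  have hr6 : r ≤ α := by nlinarith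
  have hp1 : 1 < (α + r)/2 := by linarith
  have hp6 : (α + r)/2 ≤ 6 := by linarith
  refine ⟨((α + r)/2)⁻¹, ?_, inv_lt_one_of_one_lt₀ hp1, ?_⟩
  · rw [one_div]; exact inv_anti₀ (by linarith) hp6
  · rw [inv_inv]
    have : α = ((α + r)/2)⁻¹ + (α + r)/2 := by
      have : (α + r) ≠ 0 := by linarith
      field_simp
      nlinarith
    linarith

lemma sin_lower (n k : ℕ) (κ : ℝ) (hk0 : 1 ≤ k) (hkn : k < n) (hκ : κ ≤ k) (hκ' : κ ≤ n - k) :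
    2 * κ / n ≤ Real.sin (Real.pi * k / n) := by
  have hn : (0:ℝ) < n := by exact_mod_cast (by omega : 0 < n)
  have hk : (0:ℝ) ≤ k := by positivity
  have hkn' : (k:ℝ) < n := by exact_mod_cast hkn
  have hpi := Real.pi_pos
  by_cases h : 2 * (k:ℝ) ≤ n
  · have := Real.mul_le_sin (x := Real.pi * k / n) (by positivity) (by
      rw [div_le_div_iff₀ hn (by norm_num)]; nlinarith)
    refine le_trans ?_ this
    have e : 2 / Real.pi * (Real.pi * k / n) = 2 * k / n := by field_simp
    rw [e]; gcongr
  · push Not at h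
    have e : Real.pi * k / n = Real.pi - Real.pi * (n - k) / n := by field_simp; ring
    have hnk : (0:ℝ) ≤ n - k := by linarith
    rw [e, Real.sin_pi_sub]
    have := Real.mul_le_sin (x := Real.pi * (n - k) / n) (by positivity) (by
      rw [div_le_div_iff₀ hn (by norm_num)]; nlinarith)
    refine le_trans ?_ this
    have e : 2 / Real.pi * (Real.pi * (n - k) / n) = 2 * (n - k) / n := by field_simp
    rw [e]; gcongr

lemma S_bound (n : ℕ) (c : ℝ) (hc : 0 < c) (i : Fin n) :
    0 ≤ 1 - Real.cos (((i:ℕ)+1) * (c / (n:ℝ)^2)) ∧ 1 - Real.cos (((i:ℕ)+1) * (c / (n:ℝ)^2)) ≤ c^2 / (2 * n^2)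
    ∧ |Real.sin (((i:ℕ)+1) * (c / (n:ℝ)^2))| ≤ c / n := by
  have hn : (0:ℝ) < n := by exact_mod_cast (by have := i.2; omega : 0 < n)
  have hi : ((i:ℕ):ℝ) + 1 ≤ n := by exact_mod_cast i.2
  have h1 : |((i:ℕ)+1) * (c / (n:ℝ)^2)| ≤ c / n := by
    rw [abs_of_nonneg (by positivity)]
    calc ((i:ℕ)+1) * (c / (n:ℝ)^2) ≤ n * (c / (n:ℝ)^2) := by gcongr
      _ = _ := by field_simp
  refine ⟨by linarith [Real.cos_le_one (((i:ℕ)+1) * (c / (n:ℝ)^2))], ?_, ?_⟩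
  · have := Real.one_sub_sq_div_two_le_cos (x := ((i:ℕ)+1) * (c / (n:ℝ)^2))
    have h2 : (((i:ℕ)+1) * (c / (n:ℝ)^2))^2 ≤ (c/n)^2 := by
      rw [← sq_abs]; exact pow_le_pow_left₀ (abs_nonneg _) h1 2
    have e : c^2/(2 * n^2) = (c/n)^2/2 := by field_simp
    rw [e]; linarith
  · exact Real.abs_sin_le_abs.trans h1

noncomputable def ff (n k : ℕ) (φ : ℝ) : ℝ := (Mblock n k φ).det / (Mblock n k 0).det

lemma sq_num (c κ : ℝ) (hc0 : 0 < c) (hc1 : c ≤ 1/100) (hκ1 : 1 ≤ κ) :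
    ∀ s : ℝ, 0 ≤ s → s ≤ 72 * c^2/κ → 2 * (s * Real.sqrt s) ≤ 14 * c^2 / (κ * Real.sqrt κ) := by
  intro s hs0 hs
  have hκ0 : 0 < κ := by linarith
  have hsκ : 0 < Real.sqrt κ := Real.sqrt_pos.mpr hκ0
  have h2 : Real.sqrt s ≤ 9 * c / Real.sqrt κ := by
    apply Real.sqrt_le_iff.mpr ⟨by positivity, ?_⟩
    rw [div_pow, Real.sq_sqrt hκ0.le]
    refine hs.trans ?_
    apply div_le_div_of_nonneg_right _ hκ0.le
    nlinarith
  calc 2 * (s * Real.sqrt s) ≤ 2 * (72 * c^2/κ * (9 * c / Real.sqrt κ)) := by gcongr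
    _ = (1296 * c) * c^2 / (κ * Real.sqrt κ) := by field_simp; norm_num
    _ ≤ 14 * c^2 / (κ * Real.sqrt κ) := by gcongr; linarith

lemma eta_num (n : ℕ) (a b Si Di c q κ σ : ℝ) (hn : (0:ℝ) < n) (hκ1 : 1 ≤ κ) (hc0 : 0 < c) (hc1 : c ≤ 1/100)
    (hd : 0 < 1 - q) (ha2 : |a| ≤ 2) (hS0 : 0 ≤ Si) (hS1 : Si ≤ c^2/(2 * n^2)) (hD1 : |Di| ≤ c/n)
    (hb5 : |b| ≤ 5 * (1-q)) (hκδ : κ / n ≤ 1 - q) (hσ : |σ| = 1) :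
    |a * Si + σ * (b * Di)| ≤ 6 * (1-q) * c / n := by
  have h2 : |a * Si| ≤ 2 * (c^2/(2 * n^2)) := by
    rw [abs_mul, abs_of_nonneg hS0]
    exact mul_le_mul ha2 hS1 hS0 (by norm_num)
  have h3 : |σ * (b * Di)| ≤ 5 * (1-q) * (c/n) := by
    rw [abs_mul, hσ, one_mul, abs_mul]
    exact mul_le_mul hb5 hD1 (abs_nonneg _) (by positivity)
  refine (abs_add_le _ _).trans ((add_le_add h2 h3).trans ?_)
  have e : 2 * (c^2/(2 * n^2)) = c * (1/n) * (c/n) := by field_simp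
  have h4 : (1:ℝ)/n ≤ 1 - q := le_trans (by gcongr) hκδ
  have h5 : c * (1/n) * (c/n) ≤ 1 * (1-q) * (c/n) := by
    gcongr; linarith
  rw [e]
  calc _ ≤ 1 * (1-q) * (c/n) + 5 * (1-q) * (c/n) := by linarith
    _ = _ := by ring

set_option maxHeartbeats 2000000 in
lemma bound_k (n k : ℕ) (c κ : ℝ) (hk0 : 1 ≤ k) (hkn : k < n) (hκ1 : 1 ≤ κ) (hκ : κ ≤ k) (hκ' : κ ≤ n - k)
    (hc0 : 0 < c) (hc1 : c ≤ 1/100) :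
    0 < ff n k (c/(n:ℝ)^2) ∧ 0 < ff n k (-(c/(n:ℝ)^2)) ∧
    |Real.log (ff n k (c/(n:ℝ)^2)) + Real.log (ff n k (-(c/(n:ℝ)^2)))| ≤
      328 * c^2 / (κ * Real.sqrt κ) + 4 * c^2 / n := by
  have hn1 : 1 ≤ n := by omega
  have hn : (0:ℝ) < n := by exact_mod_cast hn1
  set θ := thet n k with hθ
  set a := 2 * Real.cos θ with ha
  set b := 2 * Real.sin θ with hb
  have hb2 : b^2 = 4 - a^2 := by
    rw [ha, hb]; nlinarith [Real.sin_sq_add_cos_sq θ]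
  have ha2 : |a| ≤ 2 := by
    rw [ha, abs_mul, abs_two]; nlinarith [Real.abs_cos_le_one θ]
  have hsl := sin_lower n k κ hk0 hkn hκ hκ'
  have hm : 2 - a = 4 * Real.sin (Real.pi * k / n)^2 := by
    have : θ = 2 * (Real.pi * k / n) := by rw [hθ, thet]; ring
    rw [ha, this, Real.cos_two_mul]
    nlinarith [Real.sin_sq_add_cos_sq (Real.pi * k / n)]
  have hκn0 : 0 < 2 * κ / n := by positivity
  have hm2 : 16 * (κ/n)^2 ≤ 2 - a := by
    rw [hm]
    have : (2 * κ/n)^2 ≤ Real.sin (Real.pi * k / n)^2 := pow_le_pow_left₀ hκn0.le hsl 2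
    have e : (2 * κ/n)^2 = 4 * (κ/n)^2 := by ring
    linarith
  have hκn1 : 0 < (κ/n)^2 := by positivity
  obtain ⟨q, h6, h1, haq⟩ := exists_q a (by linarith) (abs_le.mp ha2).1
  have h0 : 0 < q := by linarith
  have hd : 0 < 1 - q := by linarith
  have hmq : (2 - a) * q = (1-q)^2 := by rw [haq]; field_simp; ring
  have hκδ : κ / n ≤ 1 - q := by
    have hh : (κ/n)^2 ≤ (1-q)^2 := by rw [← hmq]; nlinarith
    exact (abs_le_of_sq_le_sq' hh hd.le).2
  have hκn : κ ≤ n * (1-q) := by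
    rw [div_le_iff₀ hn] at hκδ; linarith
  have hGB := GB_Uq n q h0 h1 (by linarith)
  set G : Matrix (Fin n) (Fin n) ℝ := Matrix.of fun i j : Fin n => Uq q (min (i:ℕ) j + 1) * Uq q (n - max (i:ℕ) j) / Uq q (n+1) with hGdef
  have hGB' : GB n q G := hGB
  have hGs : ∀ i j, G i j = G j i := by
    intro i j
    simp only [hGdef, Matrix.of_apply, min_comm, max_comm]
  have hw0 : 0 < q⁻¹ - q := by linarith [w_ge q h0 h1]
  have hinv : Tri n (4 - a) * G = 1 := by
    apply Tri_inv n (4 - a) (Uq q)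
    · simp [Uq]
    · simp only [Uq, pow_one]; exact div_self hw0.ne'
    · intro x
      unfold Uq
      rw [haq]
      have : q⁻¹ * q = 1 := inv_mul_cancel₀ h0.ne'
      field_simp
      ring_nf
      generalize q⁻¹ ^ x = P at *
      generalize q ^ x = Q at *
      try field_simp
      try ring
    · have h2 : q⁻¹ ^ (n+1) * q ^ (n+1) = 1 := by rw [← mul_pow, inv_mul_cancel₀ h0.ne', one_pow]
      have h3 : q ^ (n+1) < 1 := pow_lt_one₀ h0.le h1 (by omega)
      have h4 : 0 < q ^ (n+1) := by positivity
      have h5 : 0 < q⁻¹ ^ (n+1) := by positivity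
      unfold Uq
      apply div_ne_zero _ hw0.ne'
      nlinarith
  have hpsd := Tri_psd n (4 - a) (by linarith [(abs_le.mp ha2).2])
  set S : Fin n → ℝ := fun i => 1 - Real.cos (((i:ℕ)+1) * (c / (n:ℝ)^2)) with hS
  set D : Fin n → ℝ := fun i => Real.sin (((i:ℕ)+1) * (c / (n:ℝ)^2)) with hD
  have hS0 : ∀ i, 0 ≤ S i := fun i => (S_bound n c hc0 i).1
  have hS1 : ∀ i, S i ≤ c^2/(2 * n^2) := fun i => (S_bound n c hc0 i).2.1
  have hD1 : ∀ i, |D i| ≤ c/n := fun i => (S_bound n c hc0 i).2.2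
  have hSD : ∀ i, 2 * S i = D i ^ 2 + S i ^ 2 := fun i => by
    simp only [hS, hD]
    nlinarith [Real.sin_sq_add_cos_sq (((i:ℕ)+1) * (c / (n:ℝ)^2))]
  have hDD : ∀ i j : Fin n, |D i - D j| ≤ c / n^2 * (dd i j : ℝ) := by
    intro i j
    have h1 : |D i - D j| ≤ |((i:ℕ)+1) * (c / (n:ℝ)^2) - ((j:ℕ)+1) * (c / (n:ℝ)^2)| := Real.abs_sin_sub_sin_le _ _
    refine h1.trans (le_of_eq ?_)
    rw [← sub_mul, abs_mul, abs_of_pos (by positivity : 0 < c/(n:ℝ)^2), mul_comm]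
    congr 1
    unfold dd
    rw [Nat.cast_sub (by omega), Nat.cast_max, Nat.cast_min, max_sub_min_eq_abs]
    rw [← abs_neg]; congr 1; ring
  have hcore := core h6 h1 hGB' hGs a (b^2) κ c haq hb2 ha2 hn1 hκ1 hκn hc0 (by linarith) S D hD1 hS0 hS1 hSD hDD
  have hb5 : |b| ≤ 5 * (1-q) := by
    have := (b2_le q a (b^2) h6 h1 haq hb2 ha2).2
    apply abs_le_of_sq_le_sq _ (by positivity)
    nlinarith [sq_nonneg (1-q)]
  have hη : ∀ i, ∀ σ : ℝ, |σ| = 1 → |a * S i + σ * (b * D i)| ≤ 6 * (1-q) * c / n := by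
    intro i σ hσ
    exact eta_num n a b (S i) (D i) c q κ σ hn hκ1 hc0 hc1 hd ha2 (hS0 i) (hS1 i) (hD1 i) hb5 hκδ hσ
  have hsb : ∀ σ : ℝ, |σ| = 1 → ∑ i, ∑ j, G i j ^ 2 * ((a * S i + σ * (b * D i)) * (a * S j + σ * (b * D j))) ≤ 72 * c^2 / κ := by
    intro σ hσ
    refine (le_abs_self _).trans ((sumG2e h0 h1 hGB' (fun i => a * S i + σ * (b * D i)) _ (fun i => hη i σ hσ)).trans ?_)
    have : (6 * (1-q) * c / n)^2 * (n * (2/(1-q)^3)) = 72 * c^2 / (n * (1-q)) := by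
      field_simp; norm_num
    rw [this]
    gcongr
  have hs4 : 72 * c^2 / κ ≤ 1/4 := by
    rw [div_le_iff₀ (by linarith)]; nlinarith
  have hsq := sq_num c κ hc0 hc1 hκ1
  have hP := aux_det (Tri n (4-a)) G hpsd hinv hGs (fun i => a * S i + 1 * (b * D i)) _ rfl ((hsb 1 (by simp)).trans hs4)
  have hM := aux_det (Tri n (4-a)) G hpsd hinv hGs (fun i => a * S i + (-1) * (b * D i)) _ rfl ((hsb (-1) (by simp)).trans hs4)
  have eP : ff n k (c/(n:ℝ)^2) = (Tri n (4-a) + Matrix.diagonal (fun i => a * S i + 1 * (b * D i))).det / (Tri n (4-a)).det := by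
    unfold ff
    rw [M_zero, M_eq]
    simp only [one_mul]; rfl
  have eM : ff n k (-(c/(n:ℝ)^2)) = (Tri n (4-a) + Matrix.diagonal (fun i => a * S i + (-1) * (b * D i))).det / (Tri n (4-a)).det := by
    unfold ff
    rw [M_zero, M_eq]
    have : (fun i : Fin n => 2 * Real.cos (thet n k) * (1 - Real.cos (((i:ℕ)+1) * -(c/(n:ℝ)^2))) + 2 * Real.sin (thet n k) * Real.sin (((i:ℕ)+1) * -(c/(n:ℝ)^2))) = (fun i => a * S i + (-1) * (b * D i)) := by
      funext i
      simp only [mul_neg, Real.cos_neg, Real.sin_neg, hS, hD, ha, hb, hθ]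
      ring
    rw [this]
  rw [← eP] at hP
  rw [← eM] at hM
  obtain ⟨p1, p2, p3⟩ := hP
  obtain ⟨m1, m2, m3⟩ := hM
  refine ⟨p1, m1, ?_⟩
  have p4 := p3.trans (hsq _ p2 (hsb 1 (by simp)))
  have m4 := m3.trans (hsq _ m2 (hsb (-1) (by simp)))
  have l1 : ∑ i, G i i * (a * S i + 1 * (b * D i)) + ∑ i, G i i * (a * S i + (-1) * (b * D i)) = 2 * a * ∑ i, G i i * S i := by
    rw [← Finset.sum_add_distrib, Finset.mul_sum]
    apply Finset.sum_congr rfl; intro i _; ring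
  have l2 : ∑ i, ∑ j, G i j ^ 2 * ((a * S i + 1 * (b * D i)) * (a * S j + 1 * (b * D j)))
      + ∑ i, ∑ j, G i j ^ 2 * ((a * S i + (-1) * (b * D i)) * (a * S j + (-1) * (b * D j)))
      = 2 * (a^2 * ∑ i, ∑ j, G i j ^ 2 * (S i * S j) + b^2 * ∑ i, ∑ j, G i j ^ 2 * (D i * D j)) := by
    simp only [Finset.mul_sum, ← Finset.sum_add_distrib]
    apply Finset.sum_congr rfl; intro i _
    apply Finset.sum_congr rfl; intro j _; ring
  have hκ2 : 300 * c^2/κ^2 ≤ 300 * c^2 / (κ * Real.sqrt κ) := by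
    have hκ0 : 0 < κ := by linarith
    have hsκ : 0 < Real.sqrt κ := Real.sqrt_pos.mpr hκ0
    have : Real.sqrt κ ≤ κ := by
      rw [Real.sqrt_le_left (by linarith)]; nlinarith
    have : κ * Real.sqrt κ ≤ κ^2 := by nlinarith
    gcongr
  have e328 : 328 * c^2 / (κ * Real.sqrt κ) = 300 * c^2 / (κ * Real.sqrt κ) + 14 * c^2 / (κ * Real.sqrt κ) + 14 * c^2 / (κ * Real.sqrt κ) := by ring
  rw [e328]
  rw [abs_le] at p4 m4 hcore ⊢
  constructor <;> linarith

lemma bound_0 (n : ℕ) (c : ℝ) (hn1 : 1 ≤ n) (hc0 : 0 < c) (hc1 : c ≤ 1/100) (φ : ℝ)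
    (hφ : φ = c/(n:ℝ)^2 ∨ φ = -(c/(n:ℝ)^2)) :
    0 < ff n 0 φ ∧ |Real.log (ff n 0 φ)| ≤ 4 * c^2 := by
  have hn : (0:ℝ) < n := by exact_mod_cast hn1
  set G : Matrix (Fin n) (Fin n) ℝ := Matrix.of fun i j : Fin n => ((min (i:ℕ) j + 1 : ℕ):ℝ) * ((n - max (i:ℕ) j : ℕ):ℝ) / ((n+1 : ℕ):ℝ) with hGdef
  have hinv : Tri n 2 * G = 1 := by
    apply Tri_inv n 2 (fun x : ℕ => (x:ℝ))
    · simp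
    · simp
    · intro x; push_cast; ring
    · positivity
  have hGs : ∀ i j, G i j = G j i := by
    intro i j
    simp only [hGdef, Matrix.of_apply, min_comm, max_comm]
  have hG0 : ∀ i j, 0 ≤ G i j := fun i j => by
    simp only [hGdef, Matrix.of_apply]; positivity
  have hG1 : ∀ i j, G i j ≤ n := fun i j => by
    simp only [hGdef, Matrix.of_apply]
    rw [div_le_iff₀ (by positivity)]
    have := i.2
    have : min (i:ℕ) j + 1 ≤ n := by omega
    have : n - max (i:ℕ) j ≤ n + 1 := by omega
    gcongr
  set S : Fin n → ℝ := fun i => 2 * (1 - Real.cos (((i:ℕ)+1) * (c / (n:ℝ)^2))) with hS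
  have hS0 : ∀ i, 0 ≤ S i := fun i => by have := (S_bound n c hc0 i).1; simp only [hS]; linarith
  have hS1 : ∀ i, S i ≤ c^2/n^2 := fun i => by
    have := (S_bound n c hc0 i).2.1
    have e : c^2/n^2 = 2 * (c^2/(2 * n^2)) := by field_simp
    rw [e]; simp only [hS]; linarith
  have hs : ∑ i, ∑ j, G i j ^ 2 * (S i * S j) ≤ c^4 := by
    calc _ ≤ ∑ i : Fin n, ∑ j : Fin n, (n:ℝ)^2 * (c^2/n^2 * (c^2/n^2)) := by
          apply Finset.sum_le_sum; intro i _
          apply Finset.sum_le_sum; intro j _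
          have := hG0 i j; have := hG1 i j; have := hS0 i; have := hS0 j; have := hS1 i; have := hS1 j
          gcongr
      _ = _ := by simp; field_simp
  have ht : ∑ i, G i i * S i ≤ c^2 := by
    calc _ ≤ ∑ i : Fin n, (n:ℝ) * (c^2/n^2) := by
          apply Finset.sum_le_sum; intro i _
          have := hG0 i i; have := hG1 i i; have := hS0 i; have := hS1 i
          gcongr
      _ = _ := by simp; field_simp
  have ht0 : 0 ≤ ∑ i, G i i * S i := Finset.sum_nonneg fun i _ => mul_nonneg (hG0 i i) (hS0 i)
  have hc4 : c^4 ≤ c^2 := pow_le_pow_of_le_one hc0.le (by linarith) (by norm_num)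
  have hc2 : c^2 ≤ 1/4 := by nlinarith
  obtain ⟨p1, p2, p3⟩ := aux_det (Tri n 2) G (Tri_psd n 2 le_rfl) hinv hGs S _ rfl (by linarith)
  have e : ff n 0 φ = (Tri n 2 + Matrix.diagonal S).det / (Tri n 2).det := by
    unfold ff
    rw [M_zero, M_eq]
    have h0 : thet n 0 = 0 := by simp [thet]
    rw [h0]
    simp only [Real.cos_zero, Real.sin_zero, mul_zero, zero_mul, add_zero, mul_one]
    rw [show (4:ℝ) - 2 = 2 by norm_num]
    rcases hφ with rfl | rfl
    · rfl
    · simp only [mul_neg, Real.cos_neg]; rfl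
  rw [← e] at p1 p3
  refine ⟨p1, ?_⟩
  set s := ∑ i, ∑ j, G i j ^ 2 * (S i * S j)
  have h2 : Real.sqrt s ≤ 1 := by
    rw [Real.sqrt_le_left (by norm_num)]; linarith
  have h3 : s * Real.sqrt s ≤ c^2 * 1 := by
    apply mul_le_mul (by linarith) h2 (Real.sqrt_nonneg _) (by positivity)
  rw [abs_le] at p3 ⊢
  constructor <;> linarith

lemma refl_sum (n : ℕ) (hn : 1 ≤ n) (φ : ℝ) :
    ∑ k ∈ Finset.range n, Real.log (ff n k φ) = ∑ k ∈ Finset.range n, Real.log (ff n k (-φ)) := by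
  have hr : ∀ k, k ≤ n → ff n (n - k) φ = ff n k (-φ) := by
    intro k hk
    unfold ff
    rw [M_refl n k φ hn hk, M_refl n k 0 hn hk, neg_zero]
  have h1 := Finset.sum_range_succ (fun k => Real.log (ff n k φ)) n
  have h2 := Finset.sum_range_succ (fun k => Real.log (ff n k (-φ))) n
  have h3 := Finset.sum_range_reflect (fun k => Real.log (ff n k φ)) (n+1)
  have h4 : ∑ j ∈ Finset.range (n+1), Real.log (ff n (n + 1 - 1 - j) φ) = ∑ j ∈ Finset.range (n+1), Real.log (ff n j (-φ)) := by
    apply Finset.sum_congr rfl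
    intro j hj
    rw [Finset.mem_range] at hj
    rw [Nat.add_sub_cancel, hr j (by omega)]
  have h5 : ff n n φ = ff n n (-φ) := by
    have a1 := hr 0 (by omega)
    have a2 : ff n 0 φ = ff n 0 (-φ) := by
      unfold ff
      congr 2
      simp only [Mblock, CharP.cast_eq_zero, mul_zero, zero_div, zero_add, mul_neg, Real.cos_neg]
    have a3 := hr n le_rfl
    simp only [Nat.sub_zero, Nat.sub_self] at a1 a3
    rw [a1, ← a2, a3]
  rw [h5] at h1
  linarith

theorem limsup_det_ratio_curvature :
    ∃ K > (0 : ℝ), ∃ c₀ > (0 : ℝ), ∀ c : ℝ, 0 < c → c ≤ c₀ →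
      Filter.limsup
        (fun n : ℕ =>
          |(∏ k ∈ Finset.range n, (Mblock n k (c / (n : ℝ) ^ 2)).det / (Mblock n k 0).det)
            - 1|)
        Filter.atTop ≤ K * c ^ 2 := by
  set h : ℕ → ℝ := fun k => 1 / ((k:ℝ) * Real.sqrt k) with hh
  have hsum : Summable h := by
    have := Real.summable_one_div_nat_rpow.mpr (by norm_num : (1:ℝ) < 3/2)
    refine this.congr fun k => ?_
    simp only [hh]
    rcases Nat.eq_zero_or_pos k with rfl | hk
    · simp
    · have : (0:ℝ) < k := by exact_mod_cast hk
      rw [show (3/2:ℝ) = 1 + 1/2 by norm_num, Real.rpow_add this, Real.rpow_one, ← Real.sqrt_eq_rpow]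
  have hh0 : ∀ k, 0 ≤ h k := fun k => by simp only [hh]; positivity
  set Z := ∑' k, h k with hZ
  have hZ0 : 0 ≤ Z := tsum_nonneg hh0
  have hZs : ∀ s : Finset ℕ, ∑ k ∈ s, h k ≤ Z := fun s => hsum.sum_le_tsum s (fun k _ => hh0 k)
  set C := 8 + 656 * Z + 4 with hC
  have hC1 : 1 ≤ C := by linarith
  refine ⟨C, by linarith, 1/(100 * C), by positivity, ?_⟩
  intro c hc0 hc
  have hc1 : c ≤ 1/100 := hc.trans (by
    apply one_div_le_one_div_of_le (by norm_num); linarith)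
  have hcC : C * c^2 ≤ 1 := by
    rw [le_div_iff₀ (by positivity)] at hc
    nlinarith
  apply Filter.limsup_le_of_le
  · exact Filter.isCoboundedUnder_le_of_le Filter.atTop (x := 0) (fun n => abs_nonneg _)
  filter_upwards [Filter.eventually_ge_atTop 1] with n hn1
  have hn : (0:ℝ) < n := by exact_mod_cast hn1
  set φ := c / (n:ℝ)^2 with hφ
  have hk : ∀ k ∈ Finset.range n, 0 < ff n k φ ∧
      |Real.log (ff n k φ) + Real.log (ff n k (-φ))| ≤ (if k = 0 then 8 * c^2 else 0) + 328 * c^2 * (h k + h (n-k)) + 4 * c^2/n := by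
    intro k hk
    rw [Finset.mem_range] at hk
    rcases Nat.eq_zero_or_pos k with rfl | hk0
    · obtain ⟨a1, a2⟩ := bound_0 n c hn1 hc0 hc1 φ (Or.inl rfl)
      obtain ⟨b1, b2⟩ := bound_0 n c hn1 hc0 hc1 (-φ) (Or.inr rfl)
      refine ⟨a1, ?_⟩
      have := hh0 0; have := hh0 (n-0)
      have h7 : 0 ≤ 328 * c^2 * (h 0 + h (n-0)) := by positivity
      have h8 : 0 ≤ 4 * c^2/n := by positivity
      rw [if_pos rfl]
      refine (abs_add_le _ _).trans ((add_le_add a2 b2).trans ?_)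
      generalize 328 * c^2 * (h 0 + h (n-0)) = X at h7 ⊢
      generalize 4 * c^2/(n:ℝ) = Y at h8 ⊢
      linarith
    · rw [if_neg (by omega)]
      have hk1 : (1:ℝ) ≤ k := by exact_mod_cast hk0
      have hk2 : (1:ℝ) ≤ n - k := by
        have : (k:ℝ) + 1 ≤ n := by exact_mod_cast hk
        linarith
      have g1 := hh0 k
      have g2 := hh0 (n-k)
      have hcast : ((n-k : ℕ):ℝ) = n - k := by rw [Nat.cast_sub hk.le]
      rcases le_total (k:ℝ) ((n:ℝ) - k) with hle | hle
      · obtain ⟨a1, -, a2⟩ := bound_k n k c k hk0 hk hk1 le_rfl hle hc0 hc1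
        refine ⟨a1, a2.trans ?_⟩
        have e : 328 * c^2 / ((k:ℝ) * Real.sqrt k) = 328 * c^2 * h k := by simp only [hh]; ring
        rw [e]
        have : 0 ≤ c^2 * h (n-k) := by positivity
        linarith
      · obtain ⟨a1, -, a2⟩ := bound_k n k c (n-k) hk0 hk hk2 hle le_rfl hc0 hc1
        refine ⟨a1, a2.trans ?_⟩
        have e : 328 * c^2 / (((n:ℝ) - k) * Real.sqrt (n-k)) = 328 * c^2 * h (n-k) := by
          simp only [hh, hcast]; ring
        rw [e]
        have : 0 ≤ c^2 * h k := by positivity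
        linarith
  set T := ∑ k ∈ Finset.range n, Real.log (ff n k φ) with hT
  have h2T : |2 * T| ≤ C * c^2 := by
    have : 2 * T = ∑ k ∈ Finset.range n, (Real.log (ff n k φ) + Real.log (ff n k (-φ))) := by
      rw [Finset.sum_add_distrib, ← refl_sum n hn1 φ]; ring
    rw [this]
    refine (Finset.abs_sum_le_sum_abs _ _).trans ((Finset.sum_le_sum fun k hk' => (hk k hk').2).trans ?_)
    rw [Finset.sum_add_distrib, Finset.sum_add_distrib, ← Finset.mul_sum, Finset.sum_add_distrib]
    have s1 : ∑ k ∈ Finset.range n, (if k = 0 then 8 * c^2 else 0) ≤ 8 * c^2 := by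
      rw [Finset.sum_ite_eq']
      split_ifs
      · exact le_rfl
      · positivity
    have s2 : ∑ k ∈ Finset.range n, h (n - k) ≤ Z := by
      have e := Finset.sum_range_reflect (fun k => h (k+1)) n
      have : ∑ k ∈ Finset.range n, h (n - k) = ∑ j ∈ Finset.range n, h (n - 1 - j + 1) := by
        apply Finset.sum_congr rfl
        intro j hj
        rw [Finset.mem_range] at hj
        congr 1; omega
      rw [this, e]
      have e2 := Finset.sum_range_succ' h n
      have := hZs (Finset.range (n+1))
      have := hh0 0
      linarith
    have s3 := hZs (Finset.range n)
    have s4 : ∑ k ∈ Finset.range n, 4 * c^2/n = 4 * c^2 := by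
      simp; field_simp
    rw [s4]
    have : 328 * c^2 * (∑ k ∈ Finset.range n, h k + ∑ k ∈ Finset.range n, h (n-k)) ≤ 328 * c^2 * (Z + Z) := by gcongr
    rw [hC]
    linarith
  have hprod : (∏ k ∈ Finset.range n, (Mblock n k φ).det / (Mblock n k 0).det) = Real.exp T := by
    rw [hT, Real.exp_sum]
    apply Finset.prod_congr rfl
    intro k hk'
    rw [Real.exp_log (hk k hk').1]; rfl
  rw [hprod]
  rw [abs_mul, abs_two] at h2T
  have := Real.abs_exp_sub_one_le (x := T) (by linarith)
  linarith
end
end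

section
/- For x ≥ 2 and n ≥ 1 define Ch_n(x) = 2cosh(n·arcosh(x/2)), so that Ch_n(β + β^{-1}) = β^n + β^{-n} for β ≥ 1. Fix τ > 0 and X ≥ 0, and set q = e^{πτ}. Let (n_i) and (m_i) be sequences of positive integers tending to infinity with n_i/m_i → τ. Then Π_{j=1}^{m_i} ( Ch_{n_i}(4 − 2cos(πj/(m_i+1))) − 2 + X ) / ( Ch_{n_i}(4 − 2cos(πj/(m_i+1))) − 1 ) converges as i → ∞ to the (convergent) infinite product Π_{j=1}^{∞} (q^j + q^{-j} − 2 + X)/(q^j + q^{-j} − 1). -/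
/-!
STATEMENT 14.  With `Ch_n(x) = 2cosh(n·arcosh(x/2))` for `x ≥ 2`, `q = e^{πτ}` and
`n_i/m_i → τ`, the probability generating function
`Π_{j=1}^{m_i} (Ch_{n_i}(4−2cos(πj/(m_i+1))) − 2 + X)/(Ch_{n_i}(4−2cos(πj/(m_i+1))) − 1)`
converges to the convergent infinite product
`Π_{j=1}^∞ (q^j + q^{−j} − 2 + X)/(q^j + q^{−j} − 1)`.
-/

open Filter Topology

noncomputable section

/-- The inverse hyperbolic cosine on `[1,∞)`. -/
def arcosh (y : ℝ) : ℝ := Real.log (y + Real.sqrt (y ^ 2 - 1))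

/-- `Ch_n(x) = 2cosh(n · arcosh(x/2))`, so that `Ch_n(β + β⁻¹) = βⁿ + β⁻ⁿ` for
`β ≥ 1`. -/
def Ch (n : ℕ) (x : ℝ) : ℝ := 2 * Real.cosh (n * arcosh (x / 2))

theorem arcosh_aux {t : ℝ} (h0 : 0 ≤ t) (h1 : t ≤ Real.pi) :
    arcosh ((4 - 2 * Real.cos t) / 2) = 2 * Real.arsinh (Real.sin (t / 2)) := by
  have hs : 0 ≤ Real.sin (t / 2) :=
    Real.sin_nonneg_of_nonneg_of_le_pi (by linarith) (by linarith)
  have ha : 0 ≤ 2 * Real.arsinh (Real.sin (t / 2)) := by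
    have := Real.arsinh_nonneg_iff.2 hs
    linarith
  have e : (4 - 2 * Real.cos t) / 2 = Real.cosh (2 * Real.arsinh (Real.sin (t / 2))) := by
    have h2 : Real.cos t = 1 - 2 * Real.sin (t / 2) ^ 2 := by
      have h3 := Real.cos_two_mul (t / 2)
      have h4 := Real.sin_sq_add_cos_sq (t / 2)
      rw [show 2 * (t / 2) = t by ring] at h3
      linarith
    rw [Real.cosh_two_mul, Real.cosh_sq, Real.sinh_arsinh, h2]
    ring
  rw [e]
  exact Real.arcosh_cosh ha

theorem arsinh_lower {s : ℝ} (h0 : 0 ≤ s) (h1 : s ≤ 1) : s ≤ 2 * Real.arsinh s := by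
  have h2 : Real.log (1 + s) ≤ Real.arsinh s := by
    unfold Real.arsinh
    apply Real.log_le_log (by linarith)
    have : (1 : ℝ) ≤ √(1 + s ^ 2) := Real.one_le_sqrt.2 (by nlinarith)
    linarith
  have h3 := Real.one_sub_inv_le_log_of_pos (show 0 < 1 + s by linarith)
  have h4 : s / 2 ≤ 1 - (1 + s)⁻¹ := by
    have : 1 - (1 + s)⁻¹ = s / (1 + s) := by field_simp; ring
    rw [this]
    apply div_le_div_of_nonneg_left h0 (by linarith) (by linarith)
  linarith

theorem factor_bound (X u : ℝ) :
    |(X - 1) / (2 * Real.cosh u - 1)| ≤ 2 * |X - 1| * Real.exp (-u) := by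
  have h1 := Real.one_le_cosh u
  have h2 : Real.exp u / 2 ≤ 2 * Real.cosh u - 1 := by
    have := Real.cosh_eq u
    have := Real.exp_pos (-u)
    linarith
  have hp := Real.exp_pos u
  rw [abs_div, abs_of_pos (show 0 < 2 * Real.cosh u - 1 by linarith), Real.exp_neg]
  calc |X - 1| / (2 * Real.cosh u - 1) ≤ |X - 1| / (Real.exp u / 2) :=
        div_le_div_of_nonneg_left (abs_nonneg _) (by linarith) h2
    _ = _ := by field_simp

theorem factor_eq (X c : ℝ) (h : 1 < c) : (c - 2 + X) / (c - 1) = 1 + (X - 1) / (c - 1) := by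
  have : c - 1 ≠ 0 := by linarith
  field_simp
  ring

theorem deriv_aux : HasDerivAt (fun t : ℝ => 2 * Real.arsinh (Real.sin (t / 2))) 1 0 := by
  have h1 : HasDerivAt (fun t : ℝ => t / 2) (1 / 2) 0 := (hasDerivAt_id (0 : ℝ)).div_const 2
  have h2 := (h1.sin.arsinh).const_mul 2
  convert! h2 using 1
  simp

theorem loop_generating_function_limit
    (τ X : ℝ) (hτ : 0 < τ) (hX : 0 ≤ X)
    (q : ℝ) (hq : q = Real.exp (Real.pi * τ))
    (n m : ℕ → ℕ)
    (hn : Tendsto n atTop atTop) (hm : Tendsto m atTop atTop)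
    (hratio : Tendsto (fun i => (n i : ℝ) / (m i : ℝ)) atTop (𝓝 τ)) :
    Multipliable (fun j : ℕ =>
      (q ^ (j + 1) + (q ^ (j + 1))⁻¹ - 2 + X) / (q ^ (j + 1) + (q ^ (j + 1))⁻¹ - 1)) ∧
    Tendsto
      (fun i => ∏ j ∈ Finset.Icc 1 (m i),
        (Ch (n i) (4 - 2 * Real.cos (Real.pi * j / (m i + 1))) - 2 + X) /
          (Ch (n i) (4 - 2 * Real.cos (Real.pi * j / (m i + 1))) - 1))
      atTop
      (𝓝 (∏' j : ℕ,
        (q ^ (j + 1) + (q ^ (j + 1))⁻¹ - 2 + X) / (q ^ (j + 1) + (q ^ (j + 1))⁻¹ - 1))) := by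
  have hq0 : ∀ j : ℕ, q ^ (j + 1) + (q ^ (j + 1))⁻¹
      = 2 * Real.cosh ((j + 1 : ℕ) * (Real.pi * τ)) := by
    intro j
    rw [hq, ← Real.exp_nat_mul, ← Real.exp_neg, Real.cosh_eq]
    ring
  have hcosh : ∀ u : ℝ, 1 < 2 * Real.cosh u := fun u => by
    have := Real.one_le_cosh u
    linarith
  have hfac : (fun j : ℕ =>
      (q ^ (j + 1) + (q ^ (j + 1))⁻¹ - 2 + X) / (q ^ (j + 1) + (q ^ (j + 1))⁻¹ - 1))
      = fun j : ℕ => 1 + (X - 1) / (2 * Real.cosh ((j + 1 : ℕ) * (Real.pi * τ)) - 1) := by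
    funext j
    rw [hq0, factor_eq _ _ (hcosh _)]
  have hgeom : ∀ c : ℝ, 0 < c →
      Summable (fun j : ℕ => 2 * |X - 1| * Real.exp (-((j + 1 : ℕ) * c))) := by
    intro c hc
    apply Summable.mul_left
    have h1 : Summable (fun j : ℕ => Real.exp (-c) ^ j) :=
      summable_geometric_of_lt_one (Real.exp_pos _).le (by simpa using hc)
    refine ((summable_nat_add_iff 1).2 h1).congr fun j => ?_
    rw [← Real.exp_nat_mul]
    congr 1
    ring
  rw [hfac]
  refine ⟨?_, ?_⟩
  · apply multipliable_one_add_of_summable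
    refine Summable.of_nonneg_of_le (fun _ => norm_nonneg _) (fun j => ?_)
      (hgeom (Real.pi * τ) (by positivity))
    exact factor_bound _ _
  let F : ℕ → ℕ → ℝ := fun i j => if j < m i then
    (X - 1) / (Ch (n i) (4 - 2 * Real.cos (Real.pi * (j + 1 : ℕ) / (m i + 1))) - 1) else 0
  have hprod : ∀ i, (∏ j ∈ Finset.Icc 1 (m i),
        (Ch (n i) (4 - 2 * Real.cos (Real.pi * j / (m i + 1))) - 2 + X) /
          (Ch (n i) (4 - 2 * Real.cos (Real.pi * j / (m i + 1))) - 1))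
      = ∏' j : ℕ, (1 + F i j) := by
    intro i
    rw [tprod_eq_prod (s := Finset.range (m i))]
    · rw [Finset.range_eq_Ico, ← Finset.Ico_add_one_right_eq_Icc]
      rw [← Finset.prod_Ico_add' _ 0 (m i) 1]
      apply Finset.prod_congr rfl
      intro j hj
      have hj' : j < m i := (Finset.mem_Ico.1 hj).2
      simp only [F, if_pos hj']
      exact factor_eq _ _ (hcosh _)
    · intro j hj
      simp only [Finset.mem_range] at hj
      simp [F, hj]
  simp_rw [hprod]
  have hmR : Tendsto (fun i => (m i : ℝ)) atTop atTop := tendsto_natCast_atTop_atTop.comp hm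
  have hm1 : Tendsto (fun i => (m i : ℝ) + 1) atTop atTop :=
    tendsto_atTop_add_const_right _ _ hmR
  have hratio1 : Tendsto (fun i => (n i : ℝ) / ((m i : ℝ) + 1)) atTop (𝓝 τ) := by
    have h1 : Tendsto (fun i => 1 - 1 / ((m i : ℝ) + 1)) atTop (𝓝 (1 - 0)) :=
      tendsto_const_nhds.sub (tendsto_const_nhds.div_atTop hm1)
    have h2 := hratio.mul h1
    rw [sub_zero, mul_one] at h2
    refine h2.congr' ?_
    filter_upwards [hm.eventually_gt_atTop 0] with i hi
    have : (0 : ℝ) < m i := by exact_mod_cast hi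
    field_simp
    ring
  have hth : ∀ i j : ℕ, j < m i → 0 ≤ Real.pi * (j + 1 : ℕ) / ((m i : ℝ) + 1) ∧
      Real.pi * (j + 1 : ℕ) / ((m i : ℝ) + 1) ≤ Real.pi := by
    intro i j hj
    refine ⟨by positivity, ?_⟩
    rw [div_le_iff₀ (by positivity)]
    apply mul_le_mul_of_nonneg_left _ Real.pi_pos.le
    have : (j + 1 : ℕ) ≤ m i + 1 := by omega
    exact_mod_cast this
  have hF : ∀ i j : ℕ, j < m i → F i j = (X - 1) / (2 * Real.cosh (n i *
      (2 * Real.arsinh (Real.sin (Real.pi * (j + 1 : ℕ) / ((m i : ℝ) + 1) / 2)))) - 1) := by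
    intro i j hj
    simp only [F, if_pos hj, Ch]
    rw [arcosh_aux (hth i j hj).1 (hth i j hj).2]
  refine tendsto_tprod_one_add_of_dominated_convergence (hgeom (τ / 2) (by positivity)) ?_ ?_
  · intro j
    have hj : ∀ᶠ i in atTop, j < m i := hm.eventually_gt_atTop j
    suffices h : Tendsto (fun i => (n i : ℝ) *
      (2 * Real.arsinh (Real.sin (Real.pi * (j + 1 : ℕ) / ((m i : ℝ) + 1) / 2)))) atTop
        (𝓝 ((j + 1 : ℕ) * (Real.pi * τ))) by
      have h2 : Tendsto (fun i => (X - 1) / (2 * Real.cosh (n i *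
          (2 * Real.arsinh (Real.sin (Real.pi * (j + 1 : ℕ) / ((m i : ℝ) + 1) / 2)))) - 1))
          atTop (𝓝 ((X - 1) / (2 * Real.cosh ((j + 1 : ℕ) * (Real.pi * τ)) - 1))) := by
        refine tendsto_const_nhds.div ((((Real.continuous_cosh.tendsto _).comp h).const_mul 2).sub
          tendsto_const_nhds) ?_
        have := hcosh ((j + 1 : ℕ) * (Real.pi * τ))
        linarith
      refine h2.congr' ?_
      filter_upwards [hj] with i hi
      rw [hF i j hi]
    have hs := hasDerivAt_iff_tendsto_slope_zero.1 deriv_aux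
    have ht : Tendsto (fun i => Real.pi * (j + 1 : ℕ) / ((m i : ℝ) + 1)) atTop (𝓝[≠] 0) := by
      apply tendsto_nhdsWithin_iff.2 ⟨tendsto_const_nhds.div_atTop hm1, ?_⟩
      refine Eventually.of_forall fun i => ?_
      have : 0 < Real.pi * (j + 1 : ℕ) / ((m i : ℝ) + 1) := by positivity
      exact this.ne'
    have h3 := (hratio1.const_mul (Real.pi * (j + 1 : ℕ))).mul (hs.comp ht)
    have e : Real.pi * (j + 1 : ℕ) * τ * 1 = (j + 1 : ℕ) * (Real.pi * τ) := by ring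
    rw [e] at h3
    refine h3.congr fun i => ?_
    have hp : Real.pi ≠ 0 := Real.pi_ne_zero
    have hj1 : ((j + 1 : ℕ) : ℝ) ≠ 0 := by positivity
    have hmi : (m i : ℝ) + 1 ≠ 0 := by positivity
    simp only [Function.comp, zero_add, zero_div, Real.sin_zero, Real.arsinh_zero, mul_zero,
      sub_zero, smul_eq_mul]
    generalize Real.arsinh _ = A
    field_simp
  · filter_upwards [hratio1.eventually (lt_mem_nhds (half_lt_self hτ))] with i hi j
    by_cases hj : j < m i
    · rw [hF i j hj]
      refine (factor_bound _ _).trans ?_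
      apply mul_le_mul_of_nonneg_left _ (by positivity)
      rw [Real.exp_le_exp, neg_le_neg_iff]
      obtain ⟨h0, h1⟩ := hth i j hj
      set t := Real.pi * (j + 1 : ℕ) / ((m i : ℝ) + 1) with htdef
      have hs := Real.mul_le_sin (x := t / 2) (by linarith) (by linarith)
      have hs2 : 2 / Real.pi * (t / 2) = (j + 1 : ℕ) / ((m i : ℝ) + 1) := by
        rw [htdef]
        have hp : Real.pi ≠ 0 := Real.pi_ne_zero
        field_simp
      rw [hs2] at hs
      have hs0 : 0 ≤ Real.sin (t / 2) := le_trans (by positivity) hs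
      have hs3 := arsinh_lower hs0 (Real.sin_le_one _)
      calc ((j + 1 : ℕ) : ℝ) * (τ / 2) ≤ (j + 1 : ℕ) * ((n i : ℝ) / ((m i : ℝ) + 1)) :=
            mul_le_mul_of_nonneg_left hi.le (by positivity)
        _ = n i * ((j + 1 : ℕ) / ((m i : ℝ) + 1)) := by ring
        _ ≤ _ := mul_le_mul_of_nonneg_left (hs.trans hs3) (by positivity)
    · simp only [F, if_neg hj, norm_zero]
      positivity
end
end
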